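/- arXiv:2512.06317 — 9 statements merged into one kernel-verified Lean document; each statement's English description precedes it below -/
import Mathlib

section
/- For a real Banach space X the following are equivalent: (1) X has the Lipschitz approximation property; (2) Id_{F(X)} lies in the 𝒯δ_c-closure of 𝓕(F(X),F(X)); (3) for every Banach space Y, whenever 𝔘 = Σ_{n=1}^∞ δ_{x_n} ⊗ y_n ∈ F(X) ⊗̂_π Y with (x_n) bounded in X, (y_n) bounded in Y, Σ‖x_n‖‖y_n‖ < ∞, and Σ_{n=1}^∞ ψ(y_n) δ_{x_n} = 0 for all ψ ∈ Y*, then 𝔘 = 0; (4) for every Banach space Y, whenever 𝔘 = Σ_{n=1}^∞ δ_{x_n} ⊗ y_n ∈ F(X) ⊗̂_π Y with (x_n) bounded in X, (y_n) bounded in Y, Σ‖x_n‖‖y_n‖ < ∞, and Σ_{n=1}^∞ φ(δ_{x_n}) y_n = 0 for all φ ∈ F(X)*, then 𝔘 = 0; (5) whenever 𝔘 = Σ_{n=1}^∞ φ_n ⊗ δ_{x_n} ∈ F(X)* ⊗̂_π F(X) with (φ_n) bounded in F(X)*, (x_n) bounded in X, Σ‖φ_n‖‖x_n‖ < ∞,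 and Σ_{n=1}^∞ φ_n(δ_x) δ_{x_n} = 0 for all x ∈ X, then 𝔘 = 0. -/
open scoped NNReal ZeroAtInfty
open Metric Set

/-- A Lipschitz map vanishing at `0` (an element of `Lip₀(X, Y)`). -/
def IsLip0 {X Y : Type*} [NormedAddCommGroup X] [NormedAddCommGroup Y] (f : X → Y) : Prop :=
  f 0 = 0 ∧ ∃ K : ℝ≥0, LipschitzWith K f

/-- A Lipschitz finite-rank operator: a Lipschitz map vanishing at `0` whose range spans a
finite-dimensional subspace (an element of `Lip₀𝓕(X, Y)`). -/
def IsLipFinRank {X Y : Type*} [NormedAddCommGroup X] [NormedAddCommGroup Y] [NormedSpace ℝ Y]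
    (f : X → Y) : Prop :=
  IsLip0 f ∧ FiniteDimensional ℝ (Submodule.span ℝ (Set.range f))

/-- A finite-rank bounded linear operator (an element of `𝓕(Z, W)`). -/
def IsFinRank {Z W : Type*} [NormedAddCommGroup Z] [NormedSpace ℝ Z] [NormedAddCommGroup W]
    [NormedSpace ℝ W] (T : Z →L[ℝ] W) : Prop :=
  FiniteDimensional ℝ (LinearMap.range (T : Z →ₗ[ℝ] W))

/-- `X` has the Lipschitz approximation property: `Id_X` lies in the `τ_c`-closure of the
Lipschitz finite-rank operators. -/
def LipAP (X : Type*) [NormedAddCommGroup X] [NormedSpace ℝ X] : Prop :=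
  ∀ K : Set X, IsCompact K → ∀ ε : ℝ, 0 < ε →
    ∃ f : X → X, IsLipFinRank f ∧ ∀ x ∈ K, ‖x - f x‖ < ε

/-- `δ : X → FX` realizes `FX` as the Lipschitz-free space `F(X)` over `X`: `δ` is an isometry
vanishing at `0` whose range has dense linear span, and every Lipschitz map `f` vanishing at `0`
into a Banach space admits a (unique, by density) bounded linear factorization `T` through `δ`
with `‖T‖ ≤ Lip(f)`. -/
structure IsFreeSpace {X FX : Type*} [NormedAddCommGroup X] [NormedSpace ℝ X]
    [NormedAddCommGroup FX] [NormedSpace ℝ FX] (δ : X → FX) : Prop where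
  map_zero : δ 0 = 0
  isometry : Isometry δ
  dense_span : Dense ((Submodule.span ℝ (Set.range δ) : Submodule ℝ FX) : Set FX)
  lift : ∀ {Y : Type*} [NormedAddCommGroup Y] [NormedSpace ℝ Y] [CompleteSpace Y]
      (f : X → Y) (K : ℝ≥0), f 0 = 0 → LipschitzWith K f →
      ∃ T : FX →L[ℝ] Y, (∀ x, T (δ x) = f x) ∧ ‖T‖ ≤ K

/-- `T` lies in the `𝒯δ_c`-closure of the finite-rank bounded linear operators, where `𝒯δ_c`
is the locally convex topology generated by the seminorms `T ↦ sup_{x ∈ K} ‖T (δ x)‖`,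
`K` ranging over compact subsets of `X`. -/
def MemTδcClosureFinRank {X FX Y : Type*} [NormedAddCommGroup X] [NormedSpace ℝ X]
    [NormedAddCommGroup FX] [NormedSpace ℝ FX] [NormedAddCommGroup Y] [NormedSpace ℝ Y]
    (δ : X → FX) (T : FX →L[ℝ] Y) : Prop :=
  ∀ K : Set X, IsCompact K → ∀ ε : ℝ, 0 < ε →
    ∃ S : FX →L[ℝ] Y, IsFinRank S ∧ ∀ x ∈ K, ‖T (δ x) - S (δ x)‖ < ε

open Filter Topology

/-- Compact sets admit finite Lipschitz partitions of unity subordinate to small balls. -/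
theorem exists_lipschitz_partition {X : Type*} [PseudoMetricSpace X] {K : Set X}
    (hK : IsCompact K) {r : ℝ} (hr : 0 < r) :
    ∃ (s : Finset X) (φ : X → X → ℝ), (∀ p, ∃ C : ℝ≥0, LipschitzWith C (φ p)) ∧
      (∀ p x, 0 ≤ φ p x) ∧ (∀ p x, 2 * r ≤ dist x p → φ p x = 0) ∧
      ∀ x ∈ K, ∑ p ∈ s, φ p x = 1 := by
  obtain ⟨t, -, htf, hcov⟩ := hK.finite_cover_balls hr
  set s := htf.toFinset
  let w : X → X → ℝ := fun p x => max 0 (2 * r - dist x p)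
  have hw0 : ∀ p x, 0 ≤ w p x := fun p x => le_max_left _ _
  have hw2 : ∀ p x, w p x ≤ 2 * r := fun p x =>
    max_le (by positivity) (by linarith [dist_nonneg (x := x) (y := p)])
  have hwL : ∀ p x z, |w p x - w p z| ≤ dist x z := by
    intro p x z
    refine (abs_max_sub_max_le_max _ _ _ _).trans ?_
    have := abs_dist_sub_le z x p
    rw [dist_comm z x] at this
    simpa using this
  let D : X → ℝ := fun x => max r (∑ p ∈ s, w p x)
  have hDr : ∀ x, r ≤ D x := fun x => le_max_left _ _
  have hD0 : ∀ x, 0 < D x := fun x => hr.trans_le (hDr x)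
  have hDL : ∀ x z, |D x - D z| ≤ s.card * dist x z := by
    intro x z
    refine (abs_max_sub_max_le_max _ _ _ _).trans ?_
    rw [sub_self, abs_zero, ← Finset.sum_sub_distrib]
    refine max_le (by positivity) ((Finset.abs_sum_le_sum_abs _ _).trans ?_)
    exact (Finset.sum_le_sum fun p _ => hwL p x z).trans (by simp)
  refine ⟨s, fun p x => w p x / D x, fun p => ?_, fun p x => div_nonneg (hw0 p x) (hD0 x).le,
    fun p x h => ?_, fun x hx => ?_⟩
  · refine ⟨Real.toNNReal (1 / r + 2 * s.card / r), LipschitzWith.of_dist_le_mul fun x z => ?_⟩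
    rw [Real.coe_toNNReal _ (by positivity), Real.dist_eq]
    have key : w p x / D x - w p z / D z
        = (w p x - w p z) / D x + w p z * (D z - D x) / (D x * D z) := by
      have := (hD0 x).ne'
      have := (hD0 z).ne'
      field_simp
      ring
    rw [key]
    refine (abs_add_le _ _).trans ?_
    rw [add_mul, abs_div, abs_div, abs_mul, abs_of_pos (hD0 x),
      abs_of_pos (mul_pos (hD0 x) (hD0 z)), abs_of_nonneg (hw0 p z), abs_sub_comm (D z)]
    refine add_le_add ?_ ?_
    · calc |w p x - w p z| / D x ≤ dist x z / r :=
            div_le_div₀ dist_nonneg (hwL p x z) hr (hDr x)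
        _ = 1 / r * dist x z := by ring
    · calc w p z * |D x - D z| / (D x * D z) ≤ 2 * r * (s.card * dist x z) / (r * r) := by
            refine div_le_div₀ (by positivity) ?_ (by positivity) ?_
            · exact mul_le_mul (hw2 p z) (hDL x z) (abs_nonneg _) (by positivity)
            · exact mul_le_mul (hDr x) (hDr z) hr.le (hD0 x).le
        _ = 2 * s.card / r * dist x z := by field_simp
  · simp only [w]
    rw [max_eq_left (by linarith), zero_div]
  · obtain ⟨p, hp, hxp⟩ := Set.mem_iUnion₂.1 (hcov hx)
    have hge : r ≤ ∑ q ∈ s, w q x :=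
      calc r ≤ w p x := (by linarith [mem_ball.1 hxp] : r ≤ 2 * r - dist x p).trans
              (le_max_right _ _)
        _ ≤ ∑ q ∈ s, w q x :=
          Finset.single_le_sum (f := fun q => w q x) (fun q _ => hw0 q x)
            (htf.mem_toFinset.2 hp)
    have hDx : D x = ∑ q ∈ s, w q x := max_eq_right hge
    rw [← Finset.sum_div, ← hDx, div_self (hD0 x).ne']

/-- An isometry vanishing at `0` is approximated uniformly on a compact set by finite sums of
scalar Lipschitz functions times values of the isometry. -/
theorem Isometry.exists_sum_lipschitz_smul_approx {X Z : Type*} [NormedAddCommGroup X]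
    [NormedAddCommGroup Z] [NormedSpace ℝ Z] {δ : X → Z} (hδ : Isometry δ) (hδ0 : δ 0 = 0)
    {K : Set X} (hK : IsCompact K) {ε : ℝ} (hε : 0 < ε) :
    ∃ (s : Finset X) (φ : X → X → ℝ), (∀ p, ∃ C : ℝ≥0, LipschitzWith C (φ p)) ∧
      (∀ p, φ p 0 = 0) ∧ ∀ x ∈ K, ‖δ x - ∑ p ∈ s, φ p x • δ p‖ < ε := by
  obtain ⟨s, φ, hL, hnn, hsupp, hsum⟩ :=
    exists_lipschitz_partition (hK.insert 0) (show 0 < ε / 5 by positivity)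
  have key : ∀ x ∈ insert 0 K, ‖δ x - ∑ p ∈ s, φ p x • δ p‖ ≤ 2 * (ε / 5) := by
    intro x hx
    have h1 : δ x - ∑ p ∈ s, φ p x • δ p = ∑ p ∈ s, φ p x • (δ x - δ p) := by
      simp only [smul_sub, Finset.sum_sub_distrib]
      rw [← Finset.sum_smul, hsum x hx, one_smul]
    rw [h1]
    calc ‖∑ p ∈ s, φ p x • (δ x - δ p)‖ ≤ ∑ p ∈ s, φ p x * (2 * (ε / 5)) := by
          refine norm_sum_le_of_le _ fun p _ => ?_
          rw [norm_smul, Real.norm_of_nonneg (hnn p x), ← dist_eq_norm, hδ.dist_eq]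
          rcases le_total (2 * (ε / 5)) (dist x p) with h | h
          · simp [hsupp p x h]
          · exact mul_le_mul_of_nonneg_left h (hnn p x)
      _ = 2 * (ε / 5) := by rw [← Finset.sum_mul, hsum x hx, one_mul]
  refine ⟨s, fun p x => φ p x - φ p 0, fun p => ?_, fun p => sub_self _, fun x hx => ?_⟩
  · obtain ⟨C, hC⟩ := hL p
    exact ⟨C, LipschitzWith.of_dist_le_mul fun a b => by
      simpa only [dist_sub_right] using hC.dist_le_mul a b⟩
  · have h0 := key 0 (Set.mem_insert _ _)
    rw [hδ0, zero_sub, norm_neg] at h0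
    have hx' := key x (Set.mem_insert_of_mem _ hx)
    have h2 : δ x - ∑ p ∈ s, (φ p x - φ p 0) • δ p
        = (δ x - ∑ p ∈ s, φ p x • δ p) + ∑ p ∈ s, φ p 0 • δ p := by
      simp only [sub_smul, Finset.sum_sub_distrib]
      abel
    rw [h2]
    exact (norm_add_le _ _).trans_lt (by linarith)

/-- Every normed space has the Lipschitz approximation property. -/
theorem lipAP (X : Type*) [NormedAddCommGroup X] [NormedSpace ℝ X] : LipAP X := by
  intro K hK ε hε
  obtain ⟨s, φ, hL, h0, happ⟩ :=
    (isometry_id (α := X)).exists_sum_lipschitz_smul_approx rfl hK hε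
  refine ⟨fun x => ∑ p ∈ s, φ p x • p, ⟨⟨by simp [h0], ?_⟩, ?_⟩, happ⟩
  · choose C hC using hL
    refine ⟨∑ p ∈ s, C p * ‖p‖₊, LipschitzWith.of_dist_le_mul fun x z => ?_⟩
    rw [dist_eq_norm, ← Finset.sum_sub_distrib]
    push_cast
    rw [Finset.sum_mul]
    refine norm_sum_le_of_le _ fun p _ => ?_
    rw [← sub_smul, norm_smul, ← dist_eq_norm, mul_right_comm]
    exact mul_le_mul_of_nonneg_right ((hC p).dist_le_mul x z) (norm_nonneg _)
  · have hle : Submodule.span ℝ (Set.range fun x => ∑ p ∈ s, φ p x • p)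
        ≤ Submodule.span ℝ (s : Set X) := by
      rw [Submodule.span_le]
      rintro _ ⟨x, rfl⟩
      exact Submodule.sum_mem _ fun p hp =>
        Submodule.smul_mem _ _ (Submodule.subset_span hp)
    exact Submodule.finiteDimensional_of_le hle

theorem IsFreeSpace.exists_real_lift {X FX : Type*} [NormedAddCommGroup X] [NormedSpace ℝ X]
    [NormedAddCommGroup FX] [NormedSpace ℝ FX] {δ : X → FX} (hδ : IsFreeSpace δ)
    {f : X → ℝ} {C : ℝ≥0} (hf : LipschitzWith C f) (h0 : f 0 = 0) :
    ∃ T : FX →L[ℝ] ℝ, ∀ x, T (δ x) = f x := by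
  obtain ⟨T, hT, -⟩ := hδ.lift (fun x => ULift.up (f x)) C (by rw [h0]; rfl)
    (fun a b => by simpa [ULift.edist_up_up] using hf a b)
  refine ⟨(ContinuousLinearEquiv.ulift : ULift ℝ ≃L[ℝ] ℝ).toContinuousLinearMap.comp T,
    fun x => ?_⟩
  rw [ContinuousLinearMap.comp_apply, hT]
  rfl

theorem IsFreeSpace.memTδcClosureFinRank_id {X FX : Type*} [NormedAddCommGroup X]
    [NormedSpace ℝ X] [NormedAddCommGroup FX] [NormedSpace ℝ FX] {δ : X → FX}
    (hδ : IsFreeSpace δ) : MemTδcClosureFinRank δ (ContinuousLinearMap.id ℝ FX) := by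
  intro K hK ε hε
  obtain ⟨s, φ, hL, h0, happ⟩ :=
    hδ.isometry.exists_sum_lipschitz_smul_approx hδ.map_zero hK hε
  have hT : ∀ p, ∃ T : FX →L[ℝ] ℝ, ∀ x, T (δ x) = φ p x := fun p =>
    let ⟨_, hC⟩ := hL p
    hδ.exists_real_lift hC (h0 p)
  choose T hT using hT
  refine ⟨∑ p ∈ s, (T p).smulRight (δ p), ?_, fun x hx => ?_⟩
  · have hle : LinearMap.range ((∑ p ∈ s, (T p).smulRight (δ p) : FX →L[ℝ] FX) : FX →ₗ[ℝ] FX)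
        ≤ Submodule.span ℝ (δ '' (s : Set X)) := by
      rintro _ ⟨z, rfl⟩
      simp only [ContinuousLinearMap.coe_coe, sum_apply,
        ContinuousLinearMap.smulRight_apply]
      exact Submodule.sum_mem _ fun p hp =>
        Submodule.smul_mem _ _ (Submodule.subset_span (Set.mem_image_of_mem _ hp))
    have := FiniteDimensional.span_of_finite ℝ (s.finite_toSet.image δ)
    exact Submodule.finiteDimensional_of_le hle
  · simpa [sum_apply, hT] using happ x hx

/-- A vector-valued discrete measure with finite first moment which annihilates the scalar
Lipschitz functions vanishing at `0` has no mass at any point `v ≠ 0`. -/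
theorem tsum_fiber_eq_zero_of_forall_lipschitz {X Z : Type*} [NormedAddCommGroup X]
    [NormedAddCommGroup Z] [NormedSpace ℝ Z] [CompleteSpace Z] {x : ℕ → X} {y : ℕ → Z}
    (hs : Summable fun n => ‖x n‖ * ‖y n‖)
    (h : ∀ (f : X → ℝ) (C : ℝ≥0), LipschitzWith C f → f 0 = 0 → ∑' n, f (x n) • y n = 0)
    {v : X} (hv : v ≠ 0) : ∑' n : x ⁻¹' {v}, y n = 0 := by
  have hv' : 0 < ‖v‖ := norm_pos_iff.2 hv
  let f : ℕ → X → ℝ := fun k u => max 0 (1 - k * dist u v)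
  have hfL : ∀ k : ℕ, LipschitzWith k (f k) := fun k => LipschitzWith.of_dist_le_mul fun a b => by
    rw [Real.dist_eq]
    refine (abs_max_sub_max_le_max _ _ _ _).trans ?_
    have h1 : (1 - k * dist a v) - (1 - k * dist b v) = k * (dist b v - dist a v) := by ring
    rw [sub_self, abs_zero, h1, abs_mul, Nat.abs_cast]
    refine max_le (by positivity) (mul_le_mul_of_nonneg_left ?_ k.cast_nonneg)
    rw [dist_comm a b]
    exact abs_dist_sub_le b a v
  have hlarge : ∀ᶠ k : ℕ in atTop, 2 / ‖v‖ ≤ k :=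
    tendsto_natCast_atTop_atTop.eventually_ge_atTop _
  have hbound : ∀ k : ℕ, 2 / ‖v‖ ≤ k → ∀ u, |f k u| ≤ 2 / ‖v‖ * ‖u‖ := by
    intro k hk u
    rw [abs_of_nonneg (le_max_left _ _)]
    refine max_le (by positivity) ?_
    have h1 : ‖v‖ ≤ ‖u‖ + dist u v := by
      rw [dist_comm, dist_eq_norm]
      simpa using norm_add_le u (v - u)
    have h2 : 2 / ‖v‖ * dist u v ≤ k * dist u v :=
      mul_le_mul_of_nonneg_right hk dist_nonneg
    have h3 : 2 / ‖v‖ * ‖v‖ ≤ 2 / ‖v‖ * (‖u‖ + dist u v) := by gcongr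
    rw [div_mul_cancel₀ _ hv'.ne'] at h3
    linarith
  have hlim : ∀ n, Tendsto (fun k => f k (x n) • y n) atTop
      (𝓝 ((x ⁻¹' {v}).indicator y n)) := by
    intro n
    by_cases hn : x n = v
    · simp [f, hn]
    · rw [Set.indicator_of_notMem (by simpa using hn)]
      refine tendsto_const_nhds.congr' ?_
      have hd : 0 < dist (x n) v := dist_pos.2 hn
      filter_upwards [(tendsto_natCast_atTop_atTop (R := ℝ)).eventually_ge_atTop
        (1 / dist (x n) v)] with k hk
      have : 1 ≤ k * dist (x n) v := (div_le_iff₀ hd).1 hk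
      simp only [f]
      rw [max_eq_left (by linarith), zero_smul]
  have hT := tendsto_tsum_of_dominated_convergence (𝓕 := atTop)
    (hs.mul_left (2 / ‖v‖)) hlim (hlarge.mono fun k hk n => by
      rw [norm_smul, ← mul_assoc]
      exact mul_le_mul_of_nonneg_right (hbound k hk _) (norm_nonneg _))
  rw [tsum_subtype]
  refine tendsto_nhds_unique hT (tendsto_const_nhds.congr' ?_)
  filter_upwards [hlarge] with k hk
  refine (h (f k) k (hfL k) ?_).symm
  simpa using hbound k hk 0

theorem tsum_eq_zero_of_forall_lipschitz {X Z : Type*} [NormedAddCommGroup X]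
    [NormedAddCommGroup Z] [NormedSpace ℝ Z] [CompleteSpace Z] {x : ℕ → X} {y : ℕ → Z}
    (hs : Summable fun n => ‖x n‖ * ‖y n‖)
    (h : ∀ (f : X → ℝ) (C : ℝ≥0), LipschitzWith C f → f 0 = 0 → ∑' n, f (x n) • y n = 0)
    (F : X → Z →L[ℝ] ℝ) {C : ℝ} (hF : ∀ u, ‖F u‖ ≤ C * ‖u‖) :
    ∑' n, F (x n) (y n) = 0 := by
  have hsum : Summable fun n => F (x n) (y n) :=
    Summable.of_norm_bounded (hs.mul_left C) fun n => by
      rw [← mul_assoc]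
      exact (F (x n)).le_of_opNorm_le (hF _) _
  refine (hsum.hasSum.tsum_fiberwise x).unique ?_
  convert hasSum_zero with v
  by_cases hv : v = 0
  · have hF0 : F 0 = 0 := norm_le_zero_iff.1 (by simpa using hF 0)
    have hz : ∀ n : x ⁻¹' {v}, F (x n) (y n) = 0 := fun n => by
      rw [show x n = 0 from n.2.trans hv, hF0, zero_apply]
    simp [hz]
  · have hv' : 0 < ‖v‖ := norm_pos_iff.2 hv
    have hy : Summable fun n : x ⁻¹' {v} => y n := by
      refine Summable.of_norm_bounded ((hs.subtype (x ⁻¹' {v})).mul_left ‖v‖⁻¹) fun n => ?_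
      have hn : x n = v := n.2
      simp [hn, inv_mul_cancel_left₀ hv'.ne']
    calc ∑' n : x ⁻¹' {v}, F (x n) (y n) = ∑' n : x ⁻¹' {v}, F v (y n) :=
          tsum_congr fun n => by rw [show x n = v from n.2]
      _ = F v (∑' n : x ⁻¹' {v}, y n) := ((F v).map_tsum hy).symm
      _ = 0 := by rw [tsum_fiber_eq_zero_of_forall_lipschitz hs h hv, map_zero]

theorem IsFreeSpace.norm_apply {X FX : Type*} [NormedAddCommGroup X] [NormedSpace ℝ X]
    [NormedAddCommGroup FX] [NormedSpace ℝ FX] {δ : X → FX} (hδ : IsFreeSpace δ) (x : X) :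
    ‖δ x‖ = ‖x‖ := by
  rw [← dist_zero_right, ← hδ.map_zero, hδ.isometry.dist_eq, dist_zero_right]

theorem IsFreeSpace.summable_smul {X FX Y : Type*} [NormedAddCommGroup X] [NormedSpace ℝ X]
    [NormedAddCommGroup FX] [NormedSpace ℝ FX] [CompleteSpace FX] [NormedAddCommGroup Y]
    [NormedSpace ℝ Y] {δ : X → FX} (hδ : IsFreeSpace δ) {x : ℕ → X} {y : ℕ → Y}
    (hs : Summable fun n => ‖x n‖ * ‖y n‖) (ψ : Y →L[ℝ] ℝ) :
    Summable fun n => ψ (y n) • δ (x n) :=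
  Summable.of_norm_bounded (hs.mul_left ‖ψ‖) fun n => by
    rw [norm_smul, hδ.norm_apply, mul_comm ‖x n‖, ← mul_assoc]
    exact mul_le_mul_of_nonneg_right (ψ.le_opNorm _) (norm_nonneg _)

theorem LipschitzWith.summable_smul {X Y : Type*} [NormedAddCommGroup X]
    [NormedAddCommGroup Y] [NormedSpace ℝ Y] [CompleteSpace Y] {x : ℕ → X} {y : ℕ → Y}
    (hs : Summable fun n => ‖x n‖ * ‖y n‖) {f : X → ℝ} {C : ℝ≥0} (hf : LipschitzWith C f)
    (h0 : f 0 = 0) : Summable fun n => f (x n) • y n :=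
  Summable.of_norm_bounded (hs.mul_left (C : ℝ)) fun n => by
    rw [norm_smul, ← mul_assoc]
    refine mul_le_mul_of_nonneg_right ?_ (norm_nonneg _)
    simpa [h0] using hf.dist_le_mul (x n) 0

/-- A Lipschitz `f` vanishing at `0` satisfies `ψ (∑ f (x n) • y n) = T (∑ ψ (y n) • δ (x n))`,
where `T` is its linearization. -/
theorem IsFreeSpace.apply_tsum_smul_eq_zero {X FX Y : Type*} [NormedAddCommGroup X]
    [NormedSpace ℝ X] [NormedAddCommGroup FX] [NormedSpace ℝ FX] [CompleteSpace FX]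
    [NormedAddCommGroup Y] [NormedSpace ℝ Y] [CompleteSpace Y] {δ : X → FX}
    (hδ : IsFreeSpace δ) {x : ℕ → X} {y : ℕ → Y} (hs : Summable fun n => ‖x n‖ * ‖y n‖)
    {ψ : Y →L[ℝ] ℝ} (hψ : ∑' n, ψ (y n) • δ (x n) = 0) {f : X → ℝ} {C : ℝ≥0}
    (hf : LipschitzWith C f) (h0 : f 0 = 0) : ψ (∑' n, f (x n) • y n) = 0 := by
  obtain ⟨T, hT⟩ := hδ.exists_real_lift hf h0
  have h := T.map_tsum (hδ.summable_smul hs ψ)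
  rw [hψ, _root_.map_zero] at h
  rw [ψ.map_tsum (hf.summable_smul hs h0), h]
  exact tsum_congr fun n => by simp [hT, mul_comm]

theorem IsFreeSpace.norm_bilin_apply_le {X FX Y : Type*} [NormedAddCommGroup X]
    [NormedSpace ℝ X] [NormedAddCommGroup FX] [NormedSpace ℝ FX] [NormedAddCommGroup Y]
    [NormedSpace ℝ Y] {δ : X → FX} (hδ : IsFreeSpace δ) (B : FX →L[ℝ] Y →L[ℝ] ℝ) (u : X) :
    ‖B (δ u)‖ ≤ ‖B‖ * ‖u‖ := by
  simpa only [hδ.norm_apply] using B.le_opNorm (δ u)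

theorem stmt_1 {X FX : Type*} [NormedAddCommGroup X] [NormedSpace ℝ X] [CompleteSpace X]
    [NormedAddCommGroup FX] [NormedSpace ℝ FX] [CompleteSpace FX]
    (δ : X → FX) (hδ : IsFreeSpace δ) :
    List.TFAE
      [ LipAP X,
        MemTδcClosureFinRank δ (ContinuousLinearMap.id ℝ FX),
        ∀ (Y : Type*) [NormedAddCommGroup Y] [NormedSpace ℝ Y] [CompleteSpace Y]
          (x : ℕ → X) (y : ℕ → Y),
          (∃ M : ℝ, ∀ n, ‖x n‖ ≤ M) → (∃ M : ℝ, ∀ n, ‖y n‖ ≤ M) →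
          Summable (fun n => ‖x n‖ * ‖y n‖) →
          (∀ ψ : Y →L[ℝ] ℝ, ∑' n, ψ (y n) • δ (x n) = 0) →
          ∀ B : FX →L[ℝ] Y →L[ℝ] ℝ, ∑' n, B (δ (x n)) (y n) = 0,
        ∀ (Y : Type*) [NormedAddCommGroup Y] [NormedSpace ℝ Y] [CompleteSpace Y]
          (x : ℕ → X) (y : ℕ → Y),
          (∃ M : ℝ, ∀ n, ‖x n‖ ≤ M) → (∃ M : ℝ, ∀ n, ‖y n‖ ≤ M) →
          Summable (fun n => ‖x n‖ * ‖y n‖) →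
          (∀ φ : FX →L[ℝ] ℝ, ∑' n, φ (δ (x n)) • y n = 0) →
          ∀ B : FX →L[ℝ] Y →L[ℝ] ℝ, ∑' n, B (δ (x n)) (y n) = 0,
        ∀ (φ : ℕ → FX →L[ℝ] ℝ) (x : ℕ → X),
          (∃ M : ℝ, ∀ n, ‖φ n‖ ≤ M) → (∃ M : ℝ, ∀ n, ‖x n‖ ≤ M) →
          Summable (fun n => ‖φ n‖ * ‖x n‖) →
          (∀ x0 : X, ∑' n, (φ n) (δ x0) • δ (x n) = 0) →
          ∀ B : (FX →L[ℝ] ℝ) →L[ℝ] FX →L[ℝ] ℝ, ∑' n, B (φ n) (δ (x n)) = 0 ] := by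
  refine List.tfae_of_forall True _ ?_
  simp only [List.mem_cons, List.not_mem_nil, or_false, forall_eq_or_imp, forall_eq, iff_true]
  refine ⟨lipAP X, hδ.memTδcClosureFinRank_id, ?_, ?_, ?_⟩
  · intro Y _ _ _ x y _ _ hs h B
    refine tsum_eq_zero_of_forall_lipschitz hs (fun f C hf h0 => ?_) (fun u => B (δ u))
      (hδ.norm_bilin_apply_le B)
    exact SeparatingDual.eq_zero_of_forall_dual_eq_zero (R := ℝ) fun ψ =>
      hδ.apply_tsum_smul_eq_zero hs (h ψ) hf h0
  · intro Y _ _ _ x y _ _ hs h B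
    refine tsum_eq_zero_of_forall_lipschitz hs (fun f C hf h0 => ?_) (fun u => B (δ u))
      (hδ.norm_bilin_apply_le B)
    obtain ⟨T, hT⟩ := hδ.exists_real_lift hf h0
    simpa only [hT] using h T
  · intro φ x _ _ hs h B
    have hs' : Summable fun n => ‖x n‖ * ‖φ n‖ := by simpa only [mul_comm] using hs
    refine tsum_eq_zero_of_forall_lipschitz hs' (fun f C hf h0 => ?_)
      (fun u => B.flip (δ u)) (hδ.norm_bilin_apply_le B.flip)
    refine ContinuousLinearMap.ext_on hδ.dense_span ?_
    rintro _ ⟨x0, rfl⟩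
    exact hδ.apply_tsum_smul_eq_zero (ψ := ContinuousLinearMap.apply ℝ ℝ (δ x0)) hs' (h x0) hf h0
end

section
/- If the Lipschitz-free space F(X) of a real Banach space X has the approximation property, then X has the Lipschitz approximation property. -/
open scoped NNReal ZeroAtInfty
open Metric Set

/-- `Z` has the (linear) approximation property: `Id_Z` lies in the `τ_c`-closure of the
finite-rank bounded linear operators. -/
def LinAP (Z : Type*) [NormedAddCommGroup Z] [NormedSpace ℝ Z] : Prop :=
  ∀ K : Set Z, IsCompact K → ∀ ε : ℝ, 0 < ε →
    ∃ S : Z →L[ℝ] Z, IsFinRank S ∧ ∀ z ∈ K, ‖z - S z‖ < ε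

namespace IsFreeSpace

variable {X FX : Type*} [NormedAddCommGroup X] [NormedSpace ℝ X]
  [NormedAddCommGroup FX] [NormedSpace ℝ FX] {δ : X → FX}

/-- Real-valued Lipschitz maps factor through `δ`, whatever the universe in which
`IsFreeSpace.lift` is available. -/
theorem exists_lift_real (hδ : IsFreeSpace δ) {f : X → ℝ} {K : ℝ≥0} (hf₀ : f 0 = 0)
    (hf : LipschitzWith K f) : ∃ T : FX →L[ℝ] ℝ, (∀ x, T (δ x) = f x) ∧ ‖T‖ ≤ K := by
  let e := LinearIsometryEquiv.ulift ℝ ℝ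
  obtain ⟨T, hT, hTK⟩ := hδ.lift (fun x => e.symm (f x)) K (by simp [hf₀])
    (by simpa using! e.symm.lipschitz.comp hf)
  refine ⟨(e : ULift ℝ →L[ℝ] ℝ).comp T, fun x => by simp [hT], ?_⟩
  refine ContinuousLinearMap.opNorm_le_bound _ K.2 fun z => ?_
  simpa using T.le_of_opNorm_le hTK z

/-- The linear combination of points of `X` is dominated in norm by the same combination of their
images in the free space. -/
theorem norm_linearCombination_id_le (hδ : IsFreeSpace δ) (c : X →₀ ℝ) :
    ‖Finsupp.linearCombination ℝ (id : X → X) c‖ ≤ ‖Finsupp.linearCombination ℝ δ c‖ := by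
  obtain ⟨g, hg, hgc⟩ := exists_dual_vector'' ℝ (Finsupp.linearCombination ℝ (id : X → X) c)
  obtain ⟨T, hT, hTg⟩ := hδ.exists_lift_real (_root_.map_zero g) g.lipschitz
  have hTc : T (Finsupp.linearCombination ℝ δ c) =
      g (Finsupp.linearCombination ℝ (id : X → X) c) := by
    simp [Finsupp.linearCombination_apply, Finsupp.sum, hT]
  calc ‖Finsupp.linearCombination ℝ (id : X → X) c‖
      = T (Finsupp.linearCombination ℝ δ c) := by rw [hTc, hgc]; rfl
    _ ≤ ‖T (Finsupp.linearCombination ℝ δ c)‖ := Real.le_norm_self _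
    _ ≤ 1 * ‖Finsupp.linearCombination ℝ δ c‖ := T.le_of_opNorm_le (hTg.trans hg) _
    _ = ‖Finsupp.linearCombination ℝ δ c‖ := one_mul _

/-- The barycenter map: a norm-one linear left inverse of `δ`. -/
theorem exists_barycenter [CompleteSpace X] (hδ : IsFreeSpace δ) :
    ∃ β : FX →L[ℝ] X, (∀ x, β (δ x) = x) ∧ ‖β‖ ≤ 1 := by
  have hdense : DenseRange (Finsupp.linearCombination ℝ δ) := by
    rw [DenseRange, ← LinearMap.coe_range, Finsupp.range_linearCombination]
    exact hδ.dense_span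
  have hnorm (c : X →₀ ℝ) : ‖Finsupp.linearCombination ℝ (id : X → X) c‖ ≤
      1 * ‖Finsupp.linearCombination ℝ δ c‖ := by
    simpa using hδ.norm_linearCombination_id_le c
  refine ⟨(Finsupp.linearCombination ℝ (id : X → X)).extendOfNorm
    (Finsupp.linearCombination ℝ δ), fun x => ?_,
    LinearMap.opNorm_extendOfNorm_le hdense zero_le_one hnorm⟩
  simpa using LinearMap.extendOfNorm_eq hdense ⟨1, hnorm⟩ (Finsupp.single x 1)

end IsFreeSpace

theorem stmt_4 {X FX : Type*} [NormedAddCommGroup X] [NormedSpace ℝ X] [CompleteSpace X]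
    [NormedAddCommGroup FX] [NormedSpace ℝ FX] [CompleteSpace FX]
    (δ : X → FX) (hδ : IsFreeSpace δ) (h : LinAP FX) : LipAP X := by
  intro K hK ε hε
  obtain ⟨β, hβ, hβ_norm⟩ := hδ.exists_barycenter
  obtain ⟨S, hS, hSK⟩ := h (δ '' K) (hK.image hδ.isometry.continuous) ε hε
  refine ⟨fun x => β (S (δ x)), ⟨⟨by simp [hδ.map_zero], _,
    (β.comp S).lipschitz.comp hδ.isometry.lipschitz⟩, ?_⟩, fun x hx => ?_⟩
  · have : FiniteDimensional ℝ (LinearMap.range (S : FX →ₗ[ℝ] FX)) := hS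
    refine Submodule.finiteDimensional_of_le
      (S₂ := (LinearMap.range (S : FX →ₗ[ℝ] FX)).map (β : FX →ₗ[ℝ] X)) ?_
    rw [Submodule.span_le]
    rintro _ ⟨x, rfl⟩
    exact Submodule.mem_map_of_mem (LinearMap.mem_range_self (S : FX →ₗ[ℝ] FX) (δ x))
  · calc ‖x - β (S (δ x))‖ = ‖β (δ x - S (δ x))‖ := by rw [map_sub, hβ]
      _ ≤ 1 * ‖δ x - S (δ x)‖ := β.le_of_opNorm_le hβ_norm _
      _ < ε := by rw [one_mul]; exact hSK _ (mem_image_of_mem δ hx)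
end

section
/- For a real Banach space X, if the Lipschitz dual X^# = Lip₀(X,ℝ) has the approximation property, then X has the Lipschitz approximation property. -/
open scoped NNReal ZeroAtInfty
open Metric Set

/-- `e` realizes `Xs` as the Lipschitz dual `X^# = Lip₀(X, ℝ)`: `e` is a linear bijection of
`Xs` onto the space of real-valued Lipschitz functions on `X` vanishing at `0`, and the norm on
`Xs` is the Lipschitz constant. -/
structure IsLipDual {X Xs : Type*} [NormedAddCommGroup X] [NormedAddCommGroup Xs]
    [NormedSpace ℝ Xs] (e : Xs →ₗ[ℝ] (X → ℝ)) : Prop where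
  inj : Function.Injective e
  surj : ∀ g : X → ℝ, g 0 = 0 → (∃ K : ℝ≥0, LipschitzWith K g) → ∃ h : Xs, e h = g
  map_zero_pt : ∀ h : Xs, e h 0 = 0
  lip_norm : ∀ h : Xs, LipschitzWith ‖h‖₊ (e h)
  norm_le : ∀ (h : Xs) (K : ℝ≥0), LipschitzWith K (e h) → ‖h‖ ≤ (K : ℝ)

open Filter Topology

/-- A Hahn-Banach criterion for lying in the closure of a submodule. -/
theorem Submodule.mem_closure_of_forall_dual {E : Type*} [NormedAddCommGroup E]
    [NormedSpace ℝ E] (V : Submodule ℝ E) (x : E)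
    (hx : ∀ φ : E →L[ℝ] ℝ, (∀ v ∈ V, φ v = 0) → φ x = 0) : x ∈ closure (V : Set E) := by
  by_contra hn
  obtain ⟨φ, u, hu, hux⟩ := geometric_hahn_banach_closed_point
    (s := closure (V : Set E)) (x := x) V.convex.closure isClosed_closure hn
  have hV : ∀ v ∈ V, φ v < u := fun v hv => hu v (subset_closure hv)
  have h0 : 0 < u := by simpa using hV 0 V.zero_mem
  have hφ : ∀ v ∈ V, φ v = 0 := by
    intro v hv
    by_contra hne
    have := hV ((u / φ v) • v) (V.smul_mem _ hv)
    rw [map_smul, smul_eq_mul, div_mul_cancel₀ _ hne] at this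
    exact lt_irrefl _ this
  have := hx φ hφ
  linarith

theorem ContinuousLinearMap.exists_half_opNorm_le {X : Type*} [NormedAddCommGroup X]
    [NormedSpace ℝ X] (φ : X →L[ℝ] ℝ) : ∃ x : X, ‖x‖ ≤ 1 ∧ ‖φ‖ / 2 ≤ φ x := by
  rcases eq_or_ne φ 0 with rfl | hφ
  · exact ⟨0, by simp⟩
  obtain ⟨x, hx, hlt⟩ := φ.exists_lt_apply_of_lt_opNorm (half_lt_self (norm_pos_iff.mpr hφ))
  rcases le_total 0 (φ x) with h | h
  · exact ⟨x, hx.le, by rw [Real.norm_of_nonneg h] at hlt; exact hlt.le⟩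
  · refine ⟨-x, by simpa using hx.le, ?_⟩
    rw [Real.norm_of_nonpos h] at hlt
    simpa using hlt.le

namespace ZeroAtInftyContinuousMap

variable {ι X : Type*} [TopologicalSpace ι] [NormedAddCommGroup X]

theorem norm_apply_le (u : C₀(ι, X)) (i : ι) : ‖u i‖ ≤ ‖u‖ :=
  u.toBCF.norm_coe_le_norm i

theorem norm_le_of_forall (u : C₀(ι, X)) {C : ℝ} (hC : 0 ≤ C) (h : ∀ i, ‖u i‖ ≤ C) :
    ‖u‖ ≤ C :=
  (BoundedContinuousFunction.norm_le (f := u.toBCF) hC).mpr h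

variable [DiscreteTopology ι]

/-- A function on a discrete space tending to `0` along the cofinite filter. -/
def ofCofinite (f : ι → X) (hf : Tendsto f cofinite (𝓝 0)) : C₀(ι, X) where
  toFun := f
  continuous_toFun := continuous_of_discreteTopology
  zero_at_infty' := by rwa [Filter.cocompact_eq_cofinite]

@[simp]
theorem ofCofinite_apply (f : ι → X) (hf : Tendsto f cofinite (𝓝 0)) (i : ι) :
    ofCofinite f hf i = f i := rfl

theorem tendsto_cofinite (u : C₀(ι, X)) : Tendsto u cofinite (𝓝 0) := by
  rw [← Filter.cocompact_eq_cofinite]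
  exact u.zero_at_infty'

variable [NormedSpace ℝ X]

open scoped Classical in
/-- The function supported at one point `i`, as a linear map. -/
noncomputable def singleLM (i : ι) : X →ₗ[ℝ] C₀(ι, X) where
  toFun x := ofCofinite (Pi.single i x) <| by
    refine tendsto_nhds_of_eventually_eq ?_
    filter_upwards [(Set.finite_singleton i).compl_mem_cofinite] with j hj
    exact Pi.single_eq_of_ne (M := fun _ => X) hj x
  map_add' x y := by
    ext j
    simp [Pi.single_add]
  map_smul' c x := by
    ext j
    simp [Pi.single_smul]

open scoped Classical in
theorem singleLM_apply (i j : ι) (x : X) :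
    singleLM i x j = if j = i then x else 0 := by
  simp [singleLM, Pi.single_apply]

/-- The embedding of `X` as the functions supported at `i`. -/
noncomputable def single (i : ι) : X →L[ℝ] C₀(ι, X) :=
  (singleLM i).mkContinuous 1 fun x => by
    refine norm_le_of_forall _ (by positivity) fun j => ?_
    rw [singleLM_apply]
    split_ifs <;> simp

open scoped Classical in
theorem single_apply (i j : ι) (x : X) : single i x j = if j = i then x else 0 :=
  singleLM_apply i j x

open scoped Classical in
theorem sum_single_apply (F : Finset ι) (y : ι → X) (j : ι) :
    (∑ i ∈ F, single i (y i) : C₀(ι, X)) j = if j ∈ F then y j else 0 := by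
  have : ∀ G : Finset ι, (∑ i ∈ G, single i (y i) : C₀(ι, X)) j = ∑ i ∈ G, single i (y i) j := by
    intro G
    induction G using Finset.induction_on with
    | empty => simp
    | insert a s ha ih => rw [Finset.sum_insert ha, Finset.sum_insert ha, add_apply, ih]
  rw [this]
  simp [single_apply]

theorem hasSum_single (u : C₀(ι, X)) : HasSum (fun i => single i (u i)) u := by
  classical
  rw [HasSum, SummationFilter.unconditional_filter, Metric.tendsto_atTop]
  intro ε hε
  have hfin : {i | ¬ ‖u i‖ < ε / 2}.Finite := by
    have := (tendsto_cofinite u).norm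
    rw [norm_zero] at this
    exact this.eventually (gt_mem_nhds (half_pos hε))
  refine ⟨hfin.toFinset, fun F hF => ?_⟩
  rw [dist_eq_norm]
  refine lt_of_le_of_lt (norm_le_of_forall _ (half_pos hε).le fun i => ?_) (half_lt_self hε)
  rw [sub_apply, sum_single_apply]
  split_ifs with hi
  · simpa using (half_pos hε).le
  · rw [zero_sub, norm_neg]
    by_contra hlt
    exact hi (hF (by simpa using (lt_of_not_ge hlt).le))

theorem hasSum_dual_apply (φ : C₀(ι, X) →L[ℝ] ℝ) (u : C₀(ι, X)) :
    HasSum (fun i => (φ ∘L single i) (u i)) (φ u) :=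
  (hasSum_single u).mapL φ

theorem summable_norm_dual_comp_single (φ : C₀(ι, X) →L[ℝ] ℝ) :
    Summable fun i => ‖φ ∘L (single i : X →L[ℝ] C₀(ι, X))‖ := by
  classical
  choose y hy hφ using fun i =>
    (φ ∘L (single i : X →L[ℝ] C₀(ι, X))).exists_half_opNorm_le
  refine summable_of_sum_le (c := 2 * ‖φ‖) (fun _ => norm_nonneg _) fun F => ?_
  have h1 : ∑ i ∈ F, ‖φ ∘L (single i : X →L[ℝ] C₀(ι, X))‖ / 2
      ≤ φ (∑ i ∈ F, single i (y i)) := by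
    rw [map_sum]
    exact Finset.sum_le_sum fun i _ => hφ i
  have h2 : ‖(∑ i ∈ F, single i (y i) : C₀(ι, X))‖ ≤ 1 := by
    refine norm_le_of_forall _ zero_le_one fun j => ?_
    rw [sum_single_apply]
    split_ifs
    · exact hy j
    · simp
  have h3 := (Real.le_norm_self _).trans (φ.le_opNorm (∑ i ∈ F, single i (y i)))
  rw [← Finset.sum_div] at h1
  nlinarith [norm_nonneg φ]

end ZeroAtInftyContinuousMap

section LipFinRank

variable {X Y : Type*} [NormedAddCommGroup X] [NormedAddCommGroup Y] [NormedSpace ℝ Y]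

/-- The Lipschitz finite-rank operators as a submodule of all maps. -/
def lipFinRankSubmodule (X Y : Type*) [NormedAddCommGroup X] [NormedAddCommGroup Y]
    [NormedSpace ℝ Y] : Submodule ℝ (X → Y) where
  carrier := {f | IsLipFinRank f}
  zero_mem' := by
    refine ⟨⟨rfl, 0, LipschitzWith.const 0⟩, ?_⟩
    refine Submodule.finiteDimensional_of_le (S₂ := ⊥) (Submodule.span_le.mpr ?_)
    rintro _ ⟨x, rfl⟩
    simp
  add_mem' := by
    rintro f g ⟨⟨hf0, K, hK⟩, hf⟩ ⟨⟨hg0, L, hL⟩, hg⟩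
    refine ⟨⟨by simp [hf0, hg0], K + L, hK.add hL⟩, ?_⟩
    refine Submodule.finiteDimensional_of_le
      (S₂ := Submodule.span ℝ (range f) ⊔ Submodule.span ℝ (range g)) (Submodule.span_le.mpr ?_)
    rintro _ ⟨x, rfl⟩
    exact Submodule.add_mem_sup (Submodule.subset_span ⟨x, rfl⟩) (Submodule.subset_span ⟨x, rfl⟩)
  smul_mem' := by
    rintro c f ⟨⟨hf0, K, hK⟩, hf⟩
    refine ⟨⟨by simp [hf0], ‖c‖₊ * K, (lipschitzWith_smul c).comp hK⟩, ?_⟩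
    refine Submodule.finiteDimensional_of_le
      (S₂ := Submodule.span ℝ (range f)) (Submodule.span_le.mpr ?_)
    rintro _ ⟨x, rfl⟩
    exact Submodule.smul_mem _ _ (Submodule.subset_span ⟨x, rfl⟩)

theorem isLipFinRank_smul_const {g : X → ℝ} (hg : IsLip0 g) (y : Y) :
    IsLipFinRank fun x => g x • y := by
  obtain ⟨h0, K, hK⟩ := hg
  refine ⟨⟨by simp [h0], K * ‖y‖₊, LipschitzWith.of_dist_le_mul fun a b => ?_⟩, ?_⟩
  · rw [dist_eq_norm, ← sub_smul, norm_smul, ← dist_eq_norm]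
    have := mul_le_mul_of_nonneg_right (hK.dist_le_mul a b) (norm_nonneg y)
    push_cast
    linarith
  · refine Submodule.finiteDimensional_of_le (S₂ := Submodule.span ℝ {y})
      (Submodule.span_le.mpr ?_)
    rintro _ ⟨x, rfl⟩
    exact Submodule.smul_mem _ _ (Submodule.mem_span_singleton_self y)

end LipFinRank

namespace IsLipDual

variable {X Xs : Type*} [NormedAddCommGroup X] [NormedAddCommGroup Xs] [NormedSpace ℝ Xs]
  {e : Xs →ₗ[ℝ] (X → ℝ)}

theorem abs_sub_le (he : IsLipDual e) (g : Xs) (x y : X) :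
    |e g x - e g y| ≤ ‖g‖ * ‖x - y‖ := by
  simpa [Real.dist_eq, dist_eq_norm] using (he.lip_norm g).dist_le_mul x y

/-- Evaluation at a point, as a continuous linear functional on the Lipschitz dual. -/
noncomputable def evalCLM (he : IsLipDual e) (x : X) : Xs →L[ℝ] ℝ :=
  ((LinearMap.proj x : (X → ℝ) →ₗ[ℝ] ℝ).comp e).mkContinuous ‖x‖ fun g => by
    simpa [he.map_zero_pt, mul_comm] using he.abs_sub_le g x 0

@[simp]
theorem evalCLM_apply (he : IsLipDual e) (x : X) (g : Xs) : he.evalCLM x g = e g x := rfl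

theorem isLip0 (he : IsLipDual e) (g : Xs) : IsLip0 (e g) :=
  ⟨he.map_zero_pt g, _, he.lip_norm g⟩

theorem exists_eq_dual [NormedSpace ℝ X] (he : IsLipDual e) (φ : X →L[ℝ] ℝ) :
    ∃ g : Xs, e g = φ ∧ ‖g‖ ≤ ‖φ‖ := by
  obtain ⟨g, hg⟩ := he.surj φ (map_zero φ) ⟨_, φ.lipschitz⟩
  exact ⟨g, hg, he.norm_le g ‖φ‖₊ (by rw [hg]; exact φ.lipschitz)⟩

end IsLipDual

/-- A finite-rank operator is a finite sum of rank-one operators. -/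
theorem IsFinRank.exists_sum {Z W : Type*} [NormedAddCommGroup Z] [NormedSpace ℝ Z]
    [NormedAddCommGroup W] [NormedSpace ℝ W] {T : Z →L[ℝ] W} (hT : IsFinRank T) :
    ∃ (n : ℕ) (Φ : Fin n → Z →L[ℝ] ℝ) (w : Fin n → W), ∀ z, T z = ∑ j, Φ j z • w j := by
  have : FiniteDimensional ℝ (LinearMap.range (T : Z →ₗ[ℝ] W)) := hT
  let b := Module.finBasis ℝ (LinearMap.range (T : Z →ₗ[ℝ] W))
  let R : Z →L[ℝ] LinearMap.range (T : Z →ₗ[ℝ] W) := T.codRestrict _ fun z => ⟨z, rfl⟩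
  refine ⟨_, fun j => (b.coord j).toContinuousLinearMap ∘L R, fun j => b j, fun z => ?_⟩
  have := congrArg Subtype.val (b.sum_repr (R z))
  rw [Submodule.coe_sum] at this
  exact this.symm

/-- The trace condition: a nuclear pairing that annihilates all `g ⊗ x` annihilates the
identity, if the Lipschitz dual has the approximation property. -/
theorem LinAP.eq_zero_of_hasSum {X Xs ι : Type*} [NormedAddCommGroup X]
    [NormedAddCommGroup Xs] [NormedSpace ℝ Xs] [CompleteSpace Xs]
    {e : Xs →ₗ[ℝ] (X → ℝ)} (he : IsLipDual e) (h : LinAP Xs)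
    {p q : ι → X} {t : ι → ℝ} (ht : ∀ i, 0 ≤ t i)
    (hpq : Tendsto (fun i => t i * ‖p i - q i‖) cofinite (𝓝 0))
    {H : ι → Xs} (hH : Summable fun i => ‖H i‖)
    (hzero : ∀ (g : Xs) (x : X), HasSum (fun i => t i * (e g (p i) - e g (q i)) * e (H i) x) 0)
    {s : ℝ} (hs : HasSum (fun i => t i * (e (H i) (p i) - e (H i) (q i))) s) : s = 0 := by
  obtain ⟨C, hC⟩ : ∃ C, ∀ i, t i * ‖p i - q i‖ ≤ C := by
    let _ : TopologicalSpace ι := ⊥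
    have _ : DiscreteTopology ι := ⟨rfl⟩
    exact ⟨_, fun i => (Real.le_norm_self _).trans
      ((ZeroAtInftyContinuousMap.ofCofinite _ hpq).norm_apply_le i)⟩
  have hpq0 : ∀ i, 0 ≤ t i * ‖p i - q i‖ := fun i => mul_nonneg (ht i) (norm_nonneg _)
  have habs : ∀ (g : Xs) i, |t i * (e g (p i) - e g (q i))| ≤ t i * ‖p i - q i‖ * ‖g‖ := by
    intro g i
    rw [abs_mul, abs_of_nonneg (ht i)]
    have := mul_le_mul_of_nonneg_left (he.abs_sub_le g (p i) (q i)) (ht i)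
    linarith
  have hvec : ∀ g : Xs, HasSum (fun i => (t i * (e g (p i) - e g (q i))) • H i) 0 := by
    intro g
    have hsum : Summable fun i => (t i * (e g (p i) - e g (q i))) • H i := by
      refine Summable.of_norm_bounded (hH.mul_left (C * ‖g‖)) fun i => ?_
      rw [norm_smul, Real.norm_eq_abs]
      refine mul_le_mul_of_nonneg_right ((habs g i).trans ?_) (norm_nonneg _)
      exact mul_le_mul_of_nonneg_right (hC i) (norm_nonneg g)
    have hz : ∑' i, (t i * (e g (p i) - e g (q i))) • H i = 0 := by
      apply he.inj
      funext x
      have h1 := hsum.hasSum.mapL (he.evalCLM x)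
      simp only [map_smul, he.evalCLM_apply] at h1
      rw [h1.unique (hzero g x)]
      simp
    simpa [hz] using hsum.hasSum
  have hS : ∀ S : Xs →L[ℝ] Xs, IsFinRank S →
      HasSum (fun i => t i * (e (S (H i)) (p i) - e (S (H i)) (q i))) 0 := by
    intro S hS
    obtain ⟨n, Φ, w, hw⟩ := hS.exists_sum
    have h1 := hasSum_sum (s := Finset.univ) fun j _ => (hvec (w j)).mapL (Φ j)
    simp only [map_zero, Finset.sum_const_zero] at h1
    refine h1.congr_fun ?_
    intro i
    simp only [hw, map_sum, map_smul, Finset.sum_apply, Pi.smul_apply, smul_eq_mul,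
      ← Finset.sum_sub_distrib, Finset.mul_sum]
    exact Finset.sum_congr rfl fun j _ => by ring
  set w : ι → Xs := fun i => (t i * ‖p i - q i‖ * ‖H i‖⁻¹) • H i with hw
  have hwlim : Tendsto w cofinite (𝓝 0) := by
    refine squeeze_zero_norm (fun i => ?_) hpq
    rw [hw, norm_smul, norm_mul, norm_inv, norm_norm, Real.norm_of_nonneg (hpq0 i), mul_assoc]
    exact mul_le_of_le_one_right (hpq0 i) (inv_mul_le_one)
  have hK : IsCompact (insert 0 (range w)) := by
    let _ : TopologicalSpace ι := ⊥
    have _ : DiscreteTopology ι := ⟨rfl⟩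
    exact hwlim.isCompact_insert_range_of_cofinite
  have hbound : ∀ η : ℝ, 0 < η → |s| ≤ η * ∑' i, ‖H i‖ := by
    intro η hη
    obtain ⟨S, hSfin, hSη⟩ := h _ hK η hη
    have h1 := hs.sub (hS S hSfin)
    rw [sub_zero] at h1
    have h2 := (hH.mul_left η).hasSum
    rw [tsum_mul_left] at h2
    rw [← Real.norm_eq_abs, ← h1.tsum_eq]
    refine tsum_of_norm_bounded h2 fun i => ?_
    have h3 := hSη (w i) (Or.inr ⟨i, rfl⟩)
    have h4 : w i - S (w i) = (t i * ‖p i - q i‖ * ‖H i‖⁻¹) • (H i - S (H i)) := by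
      rw [hw, map_smul, smul_sub]
    rw [h4, norm_smul, norm_mul, norm_inv, norm_norm, Real.norm_of_nonneg (hpq0 i)] at h3
    have h5 := habs (H i - S (H i)) i
    rw [Real.norm_eq_abs]
    have h6 : t i * (e (H i) (p i) - e (H i) (q i))
        - t i * (e (S (H i)) (p i) - e (S (H i)) (q i))
        = t i * (e (H i - S (H i)) (p i) - e (H i - S (H i)) (q i)) := by
      simp only [map_sub, Pi.sub_apply]
      ring
    rw [h6]
    refine h5.trans ?_
    rcases eq_or_ne (H i) 0 with h0 | h0
    · simp [h0]
    · have hpos : 0 < ‖H i‖ := norm_pos_iff.mpr h0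
      calc t i * ‖p i - q i‖ * ‖H i - S (H i)‖
          = (t i * ‖p i - q i‖ * ‖H i‖⁻¹ * ‖H i - S (H i)‖) * ‖H i‖ := by field_simp
        _ ≤ η * ‖H i‖ := mul_le_mul_of_nonneg_right h3.le hpos.le
  by_contra hne
  have hspos : 0 < |s| := abs_pos.mpr hne
  have hT : 0 ≤ ∑' i, ‖H i‖ := tsum_nonneg fun _ => norm_nonneg _
  have := hbound (|s| / (2 * (∑' i, ‖H i‖ + 1))) (by positivity)
  rw [div_mul_eq_mul_div, le_div_iff₀ (by positivity)] at this
  nlinarith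

/-- Approximation of the identity on a null family of weighted differences. -/
theorem LinAP.exists_isLipFinRank_sub_le {X Xs ι : Type*} [NormedAddCommGroup X]
    [NormedSpace ℝ X] [NormedAddCommGroup Xs] [NormedSpace ℝ Xs] [CompleteSpace Xs]
    {e : Xs →ₗ[ℝ] (X → ℝ)} (he : IsLipDual e) (h : LinAP Xs)
    {p q : ι → X} {t : ι → ℝ} (ht : ∀ i, 0 ≤ t i)
    (hpq : Tendsto (fun i => t i * ‖p i - q i‖) cofinite (𝓝 0)) {η : ℝ} (hη : 0 < η) :
    ∃ f : X → X, IsLipFinRank f ∧ ∀ i, t i * ‖(p i - f (p i)) - (q i - f (q i))‖ ≤ η := by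
  let _ : TopologicalSpace ι := ⊥
  have _ : DiscreteTopology ι := ⟨rfl⟩
  have hlim : ∀ f : X → X, (∃ K : ℝ≥0, LipschitzWith K f) →
      Tendsto (fun i => t i • (f (p i) - f (q i))) cofinite (𝓝 0) := by
    rintro f ⟨K, hK⟩
    refine squeeze_zero_norm (fun i => ?_) (by simpa using hpq.const_mul (K : ℝ))
    rw [norm_smul, Real.norm_of_nonneg (ht i)]
    have := mul_le_mul_of_nonneg_left (hK.dist_le_mul (p i) (q i)) (ht i)
    rw [dist_eq_norm, dist_eq_norm] at this
    linarith
  let V : Submodule ℝ C₀(ι, X) :=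
    { carrier := {u | ∃ f ∈ lipFinRankSubmodule X X, ∀ i, u i = t i • (f (p i) - f (q i))}
      zero_mem' := ⟨0, zero_mem _, fun i => by simp⟩
      add_mem' := by
        rintro u v ⟨f, hf, hu⟩ ⟨g, hg, hv⟩
        refine ⟨f + g, add_mem hf hg, fun i => ?_⟩
        rw [ZeroAtInftyContinuousMap.add_apply, hu, hv, ← smul_add, Pi.add_apply, Pi.add_apply,
          add_sub_add_comm]
      smul_mem' := by
        rintro c u ⟨f, hf, hu⟩
        refine ⟨c • f, Submodule.smul_mem _ c hf, fun i => ?_⟩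
        rw [ZeroAtInftyContinuousMap.smul_apply, hu, Pi.smul_apply, Pi.smul_apply, ← smul_sub,
          smul_comm] }
  let D : C₀(ι, X) := .ofCofinite _ (hlim id ⟨1, LipschitzWith.id⟩)
  have hD : D ∈ closure (V : Set C₀(ι, X)) := by
    refine V.mem_closure_of_forall_dual D fun φ hφ => ?_
    choose H hHeq hHnorm using fun i : ι =>
      he.exists_eq_dual (φ ∘L (ZeroAtInftyContinuousMap.single i : X →L[ℝ] C₀(ι, X)))
    have hsum : Summable fun i => ‖H i‖ :=
      (ZeroAtInftyContinuousMap.summable_norm_dual_comp_single φ).of_nonneg_of_le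
        (fun _ => norm_nonneg _) hHnorm
    have hrep : ∀ u : C₀(ι, X), HasSum (fun i => e (H i) (u i)) (φ u) := by
      intro u
      simp only [hHeq]
      exact ZeroAtInftyContinuousMap.hasSum_dual_apply φ u
    refine LinAP.eq_zero_of_hasSum he h ht hpq hsum (fun g x => ?_) (?_ : HasSum _ _)
    · have hf := isLipFinRank_smul_const (he.isLip0 g) x
      have h0 := hrep (.ofCofinite _ (hlim _ hf.1.2))
      rw [hφ _ ⟨_, hf, fun i => rfl⟩] at h0
      refine h0.congr_fun ?_
      intro i
      rw [ZeroAtInftyContinuousMap.ofCofinite_apply, ← sub_smul, smul_smul, hHeq, map_smul,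
        smul_eq_mul]
    · refine (hrep D).congr_fun ?_
      intro i
      simp only [D, ZeroAtInftyContinuousMap.ofCofinite_apply, hHeq, map_smul, map_sub, id,
        smul_eq_mul]
  obtain ⟨u, ⟨f, hf, hu⟩, hDu⟩ := Metric.mem_closure_iff.mp hD η hη
  refine ⟨f, hf, fun i => ?_⟩
  rw [dist_eq_norm] at hDu
  refine le_trans (le_of_eq ?_) (((D - u).norm_apply_le i).trans hDu.le)
  rw [ZeroAtInftyContinuousMap.sub_apply, hu, ZeroAtInftyContinuousMap.ofCofinite_apply,
    ← smul_sub, norm_smul, Real.norm_of_nonneg (ht i), id, id]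
  congr 2
  abel

/-- Finite nets of a compact set at scale `4⁻ᵏ`, starting from the single point `0`. -/
theorem IsCompact.exists_geometric_nets {X : Type*} [NormedAddCommGroup X] {K : Set X}
    (hK : IsCompact K) : ∃ (C : ℝ) (N : ℕ → Set X), 0 < C ∧ N 0 = {0} ∧ (∀ k, (N k).Finite) ∧
      ∀ k, ∀ x ∈ K, ∃ y ∈ N k, ‖x - y‖ ≤ C * (1 / 4) ^ k := by
  obtain ⟨R, hR⟩ := hK.isBounded.exists_norm_le
  have hC : 0 < max R 1 := lt_max_of_lt_right one_pos
  choose N _ hNfin hN using fun k : ℕ =>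
    hK.finite_cover_balls (e := max R 1 * (1 / 4) ^ k) (by positivity)
  refine ⟨max R 1, fun k => if k = 0 then {0} else N k, hC, by simp, fun k => ?_, fun k x hx => ?_⟩
  · dsimp only
    split_ifs
    · exact Set.finite_singleton 0
    · exact hNfin k
  · dsimp only
    split_ifs with hk
    · exact ⟨0, rfl, by simpa [hk] using Or.inl (hR x hx)⟩
    · obtain ⟨y, hy, hxy⟩ := mem_iUnion₂.mp (hN k hx)
      exact ⟨y, hy, by rw [← dist_eq_norm]; exact (mem_ball.mp hxy).le⟩

theorem stmt_5 {X Xs : Type*} [NormedAddCommGroup X] [NormedSpace ℝ X] [CompleteSpace X]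
    [NormedAddCommGroup Xs] [NormedSpace ℝ Xs] [CompleteSpace Xs]
    (e : Xs →ₗ[ℝ] (X → ℝ)) (he : IsLipDual e) (h : LinAP Xs) : LipAP X := by
  intro K hK ε hε
  obtain ⟨C, N, hC, hN0, hNfin, hN⟩ := hK.exists_geometric_nets
  let I : Set (ℕ × X × X) :=
    {a | a.2.1 ∈ N a.1 ∧ a.2.2 ∈ N (a.1 + 1) ∧ ‖a.2.1 - a.2.2‖ ≤ 2 * C * (1 / 4) ^ a.1}
  have hle : ∀ i : I, (2 : ℝ) ^ i.1.1 * ‖i.1.2.1 - i.1.2.2‖ ≤ 2 * C * (1 / 2) ^ i.1.1 := by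
    rintro ⟨⟨k, a, b⟩, -, -, hab⟩
    have h2 : (2 : ℝ) ^ k * (1 / 4) ^ k = (1 / 2) ^ k := by
      rw [← mul_pow]
      norm_num
    calc (2 : ℝ) ^ k * ‖a - b‖ ≤ 2 ^ k * (2 * C * (1 / 4) ^ k) := by gcongr
      _ = 2 * C * (1 / 2) ^ k := by rw [← h2]; ring
  have hidx : Tendsto (fun i : I => i.1.1) cofinite atTop := by
    rw [← Nat.cofinite_eq_atTop]
    refine Tendsto.cofinite_of_finite_preimage_singleton fun k => ?_
    have hfin : (({k} : Set ℕ) ×ˢ (N k ×ˢ N (k + 1))).Finite :=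
      (Set.finite_singleton k).prod ((hNfin k).prod (hNfin (k + 1)))
    refine (hfin.preimage Subtype.val_injective.injOn).subset ?_
    rintro ⟨⟨k', a, b⟩, ha, hb, -⟩ (rfl : k' = k)
    exact ⟨rfl, ha, hb⟩
  have hlim : Tendsto (fun i : I => (2 : ℝ) ^ i.1.1 * ‖i.1.2.1 - i.1.2.2‖) cofinite (𝓝 0) := by
    refine squeeze_zero (fun i => by positivity) hle ?_
    have := ((tendsto_pow_atTop_nhds_zero_of_lt_one (r := (1 / 2 : ℝ)) (by norm_num)
      (by norm_num)).const_mul (2 * C)).comp hidx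
    simpa only [mul_zero, Function.comp_def] using this
  obtain ⟨f, hf, hfI⟩ := h.exists_isLipFinRank_sub_le he (p := fun i : I => i.1.2.1)
    (q := fun i : I => i.1.2.2) (t := fun i : I => (2 : ℝ) ^ i.1.1) (fun i => by positivity) hlim
    (η := ε / 3) (by positivity)
  refine ⟨f, hf, fun x hx => ?_⟩
  obtain ⟨⟨hf0, L, hL⟩, -⟩ := hf
  choose y hyN hy using fun k => hN k x hx
  have hstep : ∀ k, ‖(y k - f (y k)) - (y (k + 1) - f (y (k + 1)))‖ ≤ ε / 3 * (1 / 2) ^ k := by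
    intro k
    have hclose : ‖y k - y (k + 1)‖ ≤ 2 * C * (1 / 4) ^ k := by
      have h1 : ‖y k - y (k + 1)‖ ≤ ‖x - y k‖ + ‖x - y (k + 1)‖ := by
        rw [norm_sub_rev x (y k)]
        simpa using norm_add_le (y k - x) (x - y (k + 1))
      have h2 := hy k
      have h3 := hy (k + 1)
      have h4 : (0 : ℝ) < C * (1 / 4) ^ k := by positivity
      rw [pow_succ] at h3
      linarith
    have h5 := hfI ⟨(k, y k, y (k + 1)), hyN k, hyN (k + 1), hclose⟩
    rw [one_div, inv_pow, ← div_eq_mul_inv, le_div_iff₀ (by positivity), mul_comm]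
    exact h5
  have hbound : ∀ k, ‖y k - f (y k)‖ ≤ ε / 3 * (2 - 2 * (1 / 2) ^ k) := by
    intro k
    induction k with
    | zero =>
      have : y 0 = 0 := by simpa [hN0] using hyN 0
      simp [this, hf0]
    | succ k ih =>
      have h1 := norm_sub_norm_le (y (k + 1) - f (y (k + 1))) (y k - f (y k))
      rw [norm_sub_rev (y (k + 1) - f (y (k + 1)))] at h1
      have h2 := hstep k
      rw [pow_succ]
      linarith
  have hylim : Tendsto y atTop (𝓝 x) := by
    rw [tendsto_iff_norm_sub_tendsto_zero]
    refine squeeze_zero (fun _ => norm_nonneg _) (g := fun k => C * (1 / 4) ^ k)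
      (fun k => by rw [norm_sub_rev]; exact hy k) ?_
    simpa using (tendsto_pow_atTop_nhds_zero_of_lt_one (r := (1 / 4 : ℝ)) (by norm_num)
      (by norm_num)).const_mul C
  have hcont : Continuous fun z => ‖z - f z‖ := (continuous_id.sub hL.continuous).norm
  have hfin : ‖x - f x‖ ≤ ε / 3 * 2 := by
    refine le_of_tendsto ((hcont.tendsto x).comp hylim) (Eventually.of_forall fun k => ?_)
    refine (hbound k).trans ?_
    gcongr
    have : (0 : ℝ) ≤ 2 * (1 / 2) ^ k := by positivity
    linarith
  linarith
end

section
/- If a real Banach space X has the approximation property, then β_X lies in the closure of 𝓕(F(X),X) in the topology of uniform convergence on compact subsets of F(X). -/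
open scoped NNReal ZeroAtInfty
open Metric Set

theorem stmt_6 {X FX : Type*} [NormedAddCommGroup X] [NormedSpace ℝ X] [CompleteSpace X]
    [NormedAddCommGroup FX] [NormedSpace ℝ FX] [CompleteSpace FX]
    (δ : X → FX) (hδ : IsFreeSpace δ)
    (β : FX →L[ℝ] X) (hβ : ∀ x : X, β (δ x) = x)
    (h : LinAP X) :
    ∀ A : Set FX, IsCompact A → ∀ ε : ℝ, 0 < ε →
      ∃ S : FX →L[ℝ] X, IsFinRank S ∧ ∀ γ ∈ A, ‖β γ - S γ‖ < ε := by
  intro A hA ε hε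
  obtain ⟨S, hS, hSε⟩ := h (β '' A) (hA.image β.continuous) ε hε
  refine ⟨S.comp β, ?_, fun γ hγ => hSε (β γ) (Set.mem_image_of_mem β hγ)⟩
  have : FiniteDimensional ℝ (LinearMap.range (S : X →ₗ[ℝ] X)) := hS
  exact Submodule.finiteDimensional_of_le
    (LinearMap.range_comp_le_range (β : FX →ₗ[ℝ] X) (S : X →ₗ[ℝ] X))
end

section
/- A real Banach space X has the Lipschitz approximation property if and only if β_X lies in the 𝒯δ_c-closure of 𝓕(F(X),X). -/
open scoped NNReal ZeroAtInfty
open Metric Set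

/-- A Lipschitz finite-rank operator factors through the Lipschitz-free space by a finite-rank
bounded linear operator. The linearization is applied to a model of the finite-dimensional range
living in the universe over which `IsFreeSpace.lift` quantifies. -/
lemma IsFreeSpace.exists_isFinRank_lift {X FX Y : Type*} [NormedAddCommGroup X] [NormedSpace ℝ X]
    [NormedAddCommGroup FX] [NormedSpace ℝ FX] [NormedAddCommGroup Y] [NormedSpace ℝ Y]
    {δ : X → FX} (hδ : IsFreeSpace δ) {f : X → Y} (hf : IsLipFinRank f) :
    ∃ S : FX →L[ℝ] Y, IsFinRank S ∧ ∀ x, S (δ x) = f x := by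
  obtain ⟨⟨hf0, K, hK⟩, hfin⟩ := hf
  set V := Submodule.span ℝ (Set.range f)
  let e : V ≃L[ℝ] (Fin (Module.finrank ℝ V) → ℝ) :=
    ContinuousLinearEquiv.ofFinrankEq (by simp)
  let u : ULift (Fin (Module.finrank ℝ V) → ℝ) ≃L[ℝ] (Fin (Module.finrank ℝ V) → ℝ) :=
    ContinuousLinearEquiv.ulift
  let g : X → V := fun x => ⟨f x, Submodule.subset_span (Set.mem_range_self x)⟩
  have hg : LipschitzWith K g := fun x y => hK x y
  have hg0 : g 0 = 0 := Subtype.ext hf0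
  let φ : V ≃L[ℝ] ULift (Fin (Module.finrank ℝ V) → ℝ) := e.trans u.symm
  obtain ⟨T, hT, -⟩ := hδ.lift (fun x => φ (g x)) _ (by simp [hg0])
    ((φ : V →L[ℝ] ULift (Fin (Module.finrank ℝ V) → ℝ)).lipschitz.comp hg)
  refine ⟨V.subtypeL ∘L (φ.symm : _ →L[ℝ] V) ∘L T, ?_, fun x => by simp [hT, g]⟩
  refine Submodule.finiteDimensional_of_le (S₂ := V) ?_
  rintro _ ⟨z, rfl⟩
  exact (φ.symm (T z)).2

/-- The composition of a finite-rank bounded linear operator with a Lipschitz map vanishing at `0`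
is a Lipschitz finite-rank operator. -/
lemma IsFinRank.isLipFinRank_comp {X Z W : Type*} [NormedAddCommGroup X]
    [NormedAddCommGroup Z] [NormedSpace ℝ Z] [NormedAddCommGroup W] [NormedSpace ℝ W]
    {S : Z →L[ℝ] W} (hS : IsFinRank S) {g : X → Z} (hg : IsLip0 g) :
    IsLipFinRank (fun x => S (g x)) := by
  obtain ⟨hg0, K, hK⟩ := hg
  refine ⟨⟨by simp [hg0], _, S.lipschitz.comp hK⟩, ?_⟩
  have : FiniteDimensional ℝ (LinearMap.range (S : Z →ₗ[ℝ] W)) := hS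
  refine Submodule.finiteDimensional_of_le (S₂ := LinearMap.range (S : Z →ₗ[ℝ] W)) ?_
  rw [Submodule.span_le]
  rintro _ ⟨x, rfl⟩
  exact ⟨g x, rfl⟩

theorem stmt_7 {X FX : Type*} [NormedAddCommGroup X] [NormedSpace ℝ X] [CompleteSpace X]
    [NormedAddCommGroup FX] [NormedSpace ℝ FX] [CompleteSpace FX]
    (δ : X → FX) (hδ : IsFreeSpace δ)
    (β : FX →L[ℝ] X) (hβ : ∀ x : X, β (δ x) = x) :
    LipAP X ↔
      ∀ K : Set X, IsCompact K → ∀ ε : ℝ, 0 < ε →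
        ∃ S : FX →L[ℝ] X, IsFinRank S ∧ ∀ x ∈ K, ‖β (δ x) - S (δ x)‖ < ε := by
  refine ⟨fun h K hK ε hε => ?_, fun h K hK ε hε => ?_⟩
  · obtain ⟨f, hf, hfK⟩ := h K hK ε hε
    obtain ⟨S, hS, hSf⟩ := hδ.exists_isFinRank_lift hf
    exact ⟨S, hS, fun x hx => by simpa only [hβ, hSf] using hfK x hx⟩
  · obtain ⟨S, hS, hSK⟩ := h K hK ε hε
    exact ⟨fun x => S (δ x), hS.isLipFinRank_comp ⟨hδ.map_zero, 1, hδ.isometry.lipschitz⟩,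
      fun x hx => by simpa only [hβ] using hSK x hx⟩
end

section
/- A real Banach space X has the Lipschitz approximation property if and only if β_X lies in the closure of Lip₀𝓕(F(X),X) in the topology of uniform convergence on compact subsets of F(X). -/
open scoped NNReal ZeroAtInfty
open Metric Set

/-- Precomposing a Lipschitz finite-rank operator with a Lipschitz map vanishing at `0` gives a
Lipschitz finite-rank operator. -/
theorem IsLipFinRank.comp {X Y Z : Type*} [NormedAddCommGroup X] [NormedAddCommGroup Y]
    [NormedAddCommGroup Z] [NormedSpace ℝ Z] {g : Y → Z} {f : X → Y}
    (hg : IsLipFinRank g) (hf : IsLip0 f) : IsLipFinRank (g ∘ f) := by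
  obtain ⟨⟨hg0, K, hK⟩, hfin⟩ := hg
  obtain ⟨hf0, L, hL⟩ := hf
  exact ⟨⟨by simp [hf0, hg0], K * L, hK.comp hL⟩,
    Submodule.finiteDimensional_of_le (Submodule.span_mono (Set.range_comp_subset_range f g))⟩

theorem stmt_8 {X FX : Type*} [NormedAddCommGroup X] [NormedSpace ℝ X] [CompleteSpace X]
    [NormedAddCommGroup FX] [NormedSpace ℝ FX] [CompleteSpace FX]
    (δ : X → FX) (hδ : IsFreeSpace δ)
    (β : FX →L[ℝ] X) (hβ : ∀ x : X, β (δ x) = x) :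
    LipAP X ↔
      ∀ A : Set FX, IsCompact A → ∀ ε : ℝ, 0 < ε →
        ∃ g : FX → X, IsLipFinRank g ∧ ∀ γ ∈ A, ‖β γ - g γ‖ < ε := by
  constructor
  · intro h A hA ε hε
    obtain ⟨f, hf, hfA⟩ := h (β '' A) (hA.image β.continuous) ε hε
    exact ⟨f ∘ β, hf.comp ⟨map_zero β, _, β.lipschitz⟩,
      fun γ hγ => hfA (β γ) (Set.mem_image_of_mem β hγ)⟩
  · intro h K hK ε hε
    obtain ⟨g, hg, hgK⟩ := h (δ '' K) (hK.image hδ.isometry.continuous) ε hε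
    exact ⟨g ∘ δ, hg.comp ⟨hδ.map_zero, 1, hδ.isometry.lipschitz⟩,
      fun x hx => by simpa [hβ] using hgK (δ x) (Set.mem_image_of_mem δ hx)⟩
end

section
/- Let 1 ≤ p < ∞. For a real Banach space X, if the Lipschitz-free space F(X) has the Lipschitz approximation property, then X has the Lipschitz p-approximation property. -/
open scoped NNReal ZeroAtInfty
open Metric Set

/-- `a` belongs to the closed unit ball of `ℓ_{p'}`, where `p'` is the conjugate exponent of
`p` (`p' = ∞` when `p = 1`, `p' = p / (p - 1)` when `p > 1`). -/
def InBallConj (p : ℝ) (a : ℕ → ℝ) : Prop :=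
  (p = 1 ∧ ∀ n, |a n| ≤ 1) ∨
    (p ≠ 1 ∧ Summable (fun n => |a n| ^ (p / (p - 1))) ∧ (∑' n, |a n| ^ (p / (p - 1))) ≤ 1)

/-- `K` is relatively `p`-compact: `K` is contained in the `p`-convex hull of a strongly
`p`-summable sequence. -/
def RelPCompact (p : ℝ) {Z : Type*} [NormedAddCommGroup Z] [NormedSpace ℝ Z]
    (K : Set Z) : Prop :=
  ∃ z : ℕ → Z, Summable (fun n => ‖z n‖ ^ p) ∧
    ∀ w ∈ K, ∃ a : ℕ → ℝ, InBallConj p a ∧ HasSum (fun n => a n • z n) w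

/-- `X` has the Lipschitz `p`-approximation property: `Id_X` lies in the `τ_p`-closure of the
Lipschitz finite-rank operators. -/
def LipPAP (p : ℝ) (X : Type*) [NormedAddCommGroup X] [NormedSpace ℝ X] : Prop :=
  ∀ K : Set X, RelPCompact p K → ∀ ε : ℝ, 0 < ε →
    ∃ f : X → X, IsLipFinRank f ∧ ∀ x ∈ K, ‖x - f x‖ < ε

theorem InBallConj.abs_le_one {p : ℝ} (hp : 1 ≤ p) {a : ℕ → ℝ} (ha : InBallConj p a) (n : ℕ) :
    |a n| ≤ 1 := by
  obtain ⟨-, h⟩ | ⟨hp1, hs, h⟩ := ha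
  · exact h n
  · have hq : 0 < p / (p - 1) :=
      div_pos (by linarith) (sub_pos.2 (lt_of_le_of_ne hp (Ne.symm hp1)))
    have hn : |a n| ^ (p / (p - 1)) ≤ 1 :=
      (hs.le_tsum n fun _ _ => by positivity).trans h
    exact not_lt.1 fun hlt => (Real.one_lt_rpow hlt hq).not_ge hn

/-- The Hölder inequality for finite sums with coefficients in the conjugate unit ball. -/
theorem InBallConj.norm_sum_smul_le {Z : Type*} [NormedAddCommGroup Z] [NormedSpace ℝ Z]
    {p : ℝ} (hp : 1 ≤ p) {a : ℕ → ℝ} (ha : InBallConj p a) (z : ℕ → Z) (t : Finset ℕ) :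
    ‖∑ n ∈ t, a n • z n‖ ≤ (∑ n ∈ t, ‖z n‖ ^ p) ^ (1 / p) := by
  have hsum : ‖∑ n ∈ t, a n • z n‖ ≤ ∑ n ∈ t, ‖z n‖ * |a n| :=
    norm_sum_le_of_le _ fun n _ => by rw [norm_smul, Real.norm_eq_abs, mul_comm]
  refine hsum.trans ?_
  obtain ⟨rfl, h⟩ | ⟨hp1, hs, h⟩ := ha
  · simpa using Finset.sum_le_sum fun n (_ : n ∈ t) =>
      mul_le_of_le_one_right (norm_nonneg (z n)) (h n)
  · have hpq : p.HolderConjugate (p / (p - 1)) :=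
      Real.HolderConjugate.conjExponent (lt_of_le_of_ne hp (Ne.symm hp1))
    refine (Real.inner_le_Lp_mul_Lq_of_nonneg t hpq (fun _ _ => norm_nonneg _)
      fun _ _ => abs_nonneg _).trans ?_
    refine mul_le_of_le_one_right (by positivity) (Real.rpow_le_one (by positivity) ?_ ?_)
    · exact (hs.sum_le_tsum t fun _ _ => by positivity).trans h
    · exact one_div_nonneg.2 hpq.symm.nonneg

theorem RelPCompact.totallyBounded {Z : Type*} [NormedAddCommGroup Z] [NormedSpace ℝ Z]
    {p : ℝ} (hp : 1 ≤ p) {K : Set Z} (hK : RelPCompact p K) : TotallyBounded K := by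
  have hp0 : 0 < p := by linarith
  obtain ⟨z, hz, hK⟩ := hK
  refine Metric.totallyBounded_iff.2 fun ε hε => ?_
  obtain ⟨s, hs⟩ := summable_iff_vanishing_norm.1 hz ((ε / 4) ^ p) (by positivity)
  have hcube : IsCompact ((fun a : ℕ → ℝ => ∑ n ∈ s, a n • z n) ''
      Set.univ.pi fun _ => Set.Icc (-1) 1) :=
    (isCompact_univ_pi fun _ => isCompact_Icc).image (by fun_prop)
  obtain ⟨t, ht, hcover⟩ := Metric.totallyBounded_iff.1 hcube.totallyBounded (ε / 2) (by positivity)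
  refine ⟨t, ht, fun w hw => ?_⟩
  obtain ⟨a, ha, haw⟩ := hK w hw
  have hmem : ∑ n ∈ s, a n • z n ∈ (fun a : ℕ → ℝ => ∑ n ∈ s, a n • z n) ''
      Set.univ.pi fun _ => Set.Icc (-1) 1 :=
    ⟨a, fun n _ => abs_le.1 (ha.abs_le_one hp n), rfl⟩
  obtain ⟨y, hy, hdist⟩ := Set.mem_iUnion₂.1 (hcover hmem)
  have htail : dist w (∑ n ∈ s, a n • z n) ≤ ε / 4 := by
    refine le_of_tendsto (haw.dist tendsto_const_nhds) ?_
    filter_upwards [Filter.eventually_ge_atTop s] with u hu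
    rw [dist_eq_norm, ← Finset.sum_sdiff hu, add_sub_cancel_right]
    refine (ha.norm_sum_smul_le hp z _).trans ?_
    refine (Real.rpow_le_rpow (by positivity)
      ((le_abs_self _).trans (hs _ Finset.sdiff_disjoint).le) (by positivity)).trans_eq ?_
    rw [← Real.rpow_mul (by positivity), mul_one_div_cancel hp0.ne', Real.rpow_one]
  refine Set.mem_iUnion₂.2 ⟨y, hy, ?_⟩
  rw [Metric.mem_ball] at hdist ⊢
  linarith [dist_triangle w (∑ n ∈ s, a n • z n) y]

/-- The barycenter map `β_X : F(X) → X`. The universal property is only used for functionals,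
since the target universe of `IsFreeSpace.lift` need not be that of `X`. -/
theorem IsFreeSpace.exists_barycenter_s13 {X FX : Type*}
    [NormedAddCommGroup X] [NormedSpace ℝ X] [CompleteSpace X]
    [NormedAddCommGroup FX] [NormedSpace ℝ FX] {δ : X → FX} (hδ : IsFreeSpace δ) :
    ∃ β : FX →L[ℝ] X, (∀ x, β (δ x) = x) ∧ ‖β‖ ≤ 1 := by
  let e := Finsupp.linearCombination ℝ δ
  let g := Finsupp.linearCombination ℝ (id : X → X)
  have hdense : DenseRange e := by
    have h := hδ.dense_span
    rwa [← Finsupp.range_linearCombination] at h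
  have hnorm : ∀ c, ‖g c‖ ≤ 1 * ‖e c‖ := by
    intro c
    obtain ⟨φ, hφ, hφc⟩ := exists_dual_vector'' ℝ (g c)
    have hlip : LipschitzWith 1 fun x => ULift.up (φ x) :=
      LipschitzWith.of_dist_le_mul fun x y =>
        (φ.lipschitz.dist_le_mul x y).trans (mul_le_mul_of_nonneg_right hφ dist_nonneg)
    obtain ⟨T, hT, hT1⟩ := hδ.lift _ 1 (by simp; rfl) hlip
    have hTe : (ULift.moduleEquiv : ULift ℝ ≃ₗ[ℝ] ℝ).toLinearMap ∘ₗ (T : FX →ₗ[ℝ] ULift ℝ) ∘ₗ e =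
        (φ : X →ₗ[ℝ] ℝ) ∘ₗ g :=
      Finsupp.lhom_ext fun x r => by simp [e, g, hT]
    have hTc : (T (e c)).down = ‖g c‖ := (LinearMap.congr_fun hTe c).trans hφc
    have hle := T.le_of_opNorm_le hT1 (e c)
    rw [ULift.norm_def, hTc] at hle
    simpa using hle
  refine ⟨g.extendOfNorm e, fun x => ?_, LinearMap.opNorm_extendOfNorm_le hdense zero_le_one hnorm⟩
  simpa [e, g] using LinearMap.extendOfNorm_eq hdense ⟨1, hnorm⟩ (Finsupp.single x 1)

theorem stmt_13 (p : ℝ) (hp : 1 ≤ p) {X FX : Type*}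
    [NormedAddCommGroup X] [NormedSpace ℝ X] [CompleteSpace X]
    [NormedAddCommGroup FX] [NormedSpace ℝ FX] [CompleteSpace FX]
    (δ : X → FX) (hδ : IsFreeSpace δ) (h : LipAP FX) : LipPAP p X := by
  intro K hK ε hε
  obtain ⟨β, hβδ, hβ⟩ := hδ.exists_barycenter_s13
  obtain ⟨f, ⟨⟨hf0, C, hf⟩, hfin⟩, hfε⟩ :=
    h (δ '' closure K) (((hK.totallyBounded hp).closure.isCompact_of_isClosed
      isClosed_closure).image hδ.isometry.continuous) ε hε
  refine ⟨fun x => β (f (δ x)), ⟨⟨by simp [hδ.map_zero, hf0], _,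
    β.lipschitz.comp (hf.comp hδ.isometry.lipschitz)⟩, ?_⟩, fun x hx => ?_⟩
  · have hsub : Submodule.span ℝ (Set.range fun x => β (f (δ x))) ≤
        (Submodule.span ℝ (Set.range f)).map (β : FX →ₗ[ℝ] X) := by
      rw [Submodule.span_le]
      rintro _ ⟨x, rfl⟩
      exact ⟨_, Submodule.subset_span ⟨δ x, rfl⟩, rfl⟩
    exact Submodule.finiteDimensional_of_le hsub
  · calc ‖x - β (f (δ x))‖ = ‖β (δ x - f (δ x))‖ := by rw [map_sub, hβδ]
      _ ≤ 1 * ‖δ x - f (δ x)‖ := β.le_of_opNorm_le hβ _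
      _ < ε := by simpa using hfε _ ⟨x, subset_closure hx, rfl⟩
end

section
/- Let 1 ≤ p < ∞ and let X and Y be real Banach spaces. Then L(X,Y) is contained in the τ_p-closure of 𝓕(X,Y) if and only if for every T ∈ L(X,Y), the operator T ∘ β_X lies in the closure of 𝓕(F(X),Y) in the topology of uniform convergence on relatively p-compact subsets of F(X). -/
open scoped NNReal ZeroAtInfty
open Metric Set

open Filter Topology

section Averaging

variable {X F : Type*} [NormedAddCommGroup X] [NormedAddCommGroup F]

lemma Continuous.intervalIntegrable_line [NormedSpace ℝ X] {g : X → F} (hg : Continuous g)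
    (x e : X) (a b : ℝ) :
    IntervalIntegrable (fun s : ℝ => g (x + s • e)) MeasureTheory.volume a b :=
  Continuous.intervalIntegrable (by fun_prop) a b

lemma LipschitzWith.fwdDiff {K : ℝ≥0} {g : X → F} (hg : LipschitzWith K g) (v : X) :
    LipschitzWith (K + K) (fwdDiff v g) := by
  have h : LipschitzWith K (fun x => g (x + v)) := LipschitzWith.of_dist_le_mul fun x y => by
    simpa using hg.dist_le_mul (x + v) (y + v)
  exact h.sub hg

lemma LipschitzWith.norm_fwdDiff_le {K : ℝ≥0} {g : X → F} (hg : LipschitzWith K g) (v x : X) :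
    ‖_root_.fwdDiff v g x‖ ≤ K * ‖v‖ := by
  simpa [_root_.fwdDiff, dist_eq_norm] using hg.dist_le_mul (x + v) x

lemma LipschitzWith.real_smul [NormedSpace ℝ F] {K : ℝ≥0} {g : X → F}
    (hg : LipschitzWith K g) (c : ℝ) :
    LipschitzWith (‖c‖₊ * K) (c • g) :=
  (lipschitzWith_smul c).comp hg

variable [NormedSpace ℝ X] [NormedSpace ℝ F]

/-- The average of `g` along the segment from `x` to `x + e`. -/
noncomputable def segAvg (e : X) (g : X → F) (x : X) : F :=
  ∫ s in (0 : ℝ)..1, g (x + s • e)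

/-- The average of `g` along the parallelepiped with edges `e 0, …, e (n - 1)`. -/
noncomputable def boxAvg (e : ℕ → X) : ℕ → (X → F) → X → F
  | 0, g => g
  | n + 1, g => boxAvg e n (segAvg (e n) g)

lemma norm_segAvg_le {e : X} {g : X → F} {B : ℝ} (h : ∀ x, ‖g x‖ ≤ B) (x : X) :
    ‖segAvg e g x‖ ≤ B := by
  simpa [segAvg] using intervalIntegral.norm_integral_le_of_norm_le_const
    (a := 0) (b := 1) (f := fun s : ℝ => g (x + s • e)) (fun s _ => h _)

lemma segAvg_sub {e : X} {g h : X → F} (hg : Continuous g) (hh : Continuous h) :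
    segAvg e (g - h) = segAvg e g - segAvg e h := by
  ext x
  exact intervalIntegral.integral_sub (hg.intervalIntegrable_line x e 0 1)
    (hh.intervalIntegrable_line x e 0 1)

lemma segAvg_smul (e : X) (c : ℝ) (g : X → F) : segAvg e (c • g) = c • segAvg e g := by
  ext x
  simp [segAvg]

lemma segAvg_fwdDiff {e : X} {g : X → F} (hg : Continuous g) (v : X) :
    segAvg e (fwdDiff v g) = fwdDiff v (segAvg e g) := by
  ext x
  have h := intervalIntegral.integral_sub (hg.intervalIntegrable_line (x + v) e 0 1)
    (hg.intervalIntegrable_line x e 0 1)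
  simp only [segAvg, fwdDiff, ← h]
  congr! 4
  abel

lemma LipschitzWith.segAvg {K : ℝ≥0} {g : X → F} (hg : LipschitzWith K g) (e : X) :
    LipschitzWith K (segAvg e g) := by
  refine LipschitzWith.of_dist_le_mul fun x y => ?_
  rw [dist_eq_norm, _root_.segAvg, _root_.segAvg, ← intervalIntegral.integral_sub
    (hg.continuous.intervalIntegrable_line x e 0 1) (hg.continuous.intervalIntegrable_line y e 0 1)]
  refine (intervalIntegral.norm_integral_le_of_norm_le_const (C := K * dist x y)
    fun s _ => ?_).trans (by simp)
  rw [← dist_eq_norm]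
  simpa using hg.dist_le_mul (x + s • e) (y + s • e)

/-- Fundamental theorem of calculus for difference operators: averaging along `e` turns the
difference in direction `t • e` into an integral over `[0, t]` of the difference along `e`. -/
lemma segAvg_fwdDiff_smul_self {e : X} {g : X → F} (hg : Continuous g) (t : ℝ) (x : X) :
    segAvg e (fwdDiff (t • e) g) x = ∫ s in (0 : ℝ)..t, fwdDiff e g (x + s • e) := by
  have i := fun y a b => hg.intervalIntegrable_line y e a b
  have hl : segAvg e (fwdDiff (t • e) g) x =
      (∫ s in (0 : ℝ)..1, g (x + (s + t) • e)) - ∫ s in (0 : ℝ)..1, g (x + s • e) := by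
    have h := intervalIntegral.integral_sub (i (x + t • e) 0 1) (i x 0 1)
    have h' : ∀ s : ℝ, x + (s + t) • e = x + t • e + s • e := fun s => by rw [add_smul]; abel
    simp only [segAvg, fwdDiff, h', ← h]
    congr! 4
    abel
  have hr : (∫ s in (0 : ℝ)..t, fwdDiff e g (x + s • e)) =
      (∫ s in (0 : ℝ)..t, g (x + (s + 1) • e)) - ∫ s in (0 : ℝ)..t, g (x + s • e) := by
    have h := intervalIntegral.integral_sub (i (x + e) 0 t) (i x 0 t)
    have h' : ∀ s : ℝ, x + (s + 1) • e = x + e + s • e := fun s => by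
      rw [add_smul, one_smul]; abel
    simp only [fwdDiff, h', ← h]
    congr! 4
    abel
  rw [hl, hr, intervalIntegral.integral_comp_add_right (fun s : ℝ => g (x + s • e)),
    intervalIntegral.integral_comp_add_right (fun s : ℝ => g (x + s • e)),
    intervalIntegral.integral_interval_sub_interval_comm' (i x _ _) (i x _ _) (i x _ _),
    add_comm t 1]
  simp

lemma norm_segAvg_fwdDiff_smul_self_le {e : X} {g : X → F} (hg : Continuous g) {B : ℝ}
    (hB : ∀ x, ‖g x‖ ≤ B) (t : ℝ) (x : X) :
    ‖segAvg e (fwdDiff (t • e) g) x‖ ≤ 2 * B * |t| := by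
  rw [segAvg_fwdDiff_smul_self hg]
  refine (intervalIntegral.norm_integral_le_of_norm_le_const (C := 2 * B) fun s _ => ?_).trans
    (by simp)
  exact (norm_sub_le _ _).trans (by linarith [hB (x + s • e + e), hB (x + s • e)])

lemma norm_inv_smul_segAvg_sub_le [CompleteSpace F] {K : ℝ≥0} {e : X} {g : X → F}
    (hg : LipschitzWith K g) {t : ℝ} (ht : t ≠ 0) (x : X) :
    ‖t⁻¹ • segAvg e (fwdDiff (t • e) g) x - fwdDiff e g x‖ ≤ 2 * K * ‖e‖ * |t| := by
  have hc := (hg.fwdDiff e).continuous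
  have h : t⁻¹ • segAvg e (fwdDiff (t • e) g) x - fwdDiff e g x =
      t⁻¹ • ∫ s in (0 : ℝ)..t, (fwdDiff e g (x + s • e) - fwdDiff e g x) := by
    rw [segAvg_fwdDiff_smul_self hg.continuous, intervalIntegral.integral_sub
      (hc.intervalIntegrable_line x e 0 t) (by simp), intervalIntegral.integral_const, smul_sub,
      smul_smul]
    simp [ht]
  have hb : ‖∫ s in (0 : ℝ)..t, (fwdDiff e g (x + s • e) - fwdDiff e g x)‖ ≤
      2 * K * (|t| * ‖e‖) * |t| := by
    refine (intervalIntegral.norm_integral_le_of_norm_le_const (C := 2 * K * (|t| * ‖e‖))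
      fun s hs => ?_).trans (by simp)
    have h1 := (hg.fwdDiff e).dist_le_mul (x + s • e) x
    have h2 : |s| ≤ |t| := by
      have := abs_sub_left_of_mem_uIcc (uIoc_subset_uIcc hs)
      simpa using this
    rw [dist_eq_norm, dist_eq_norm, add_sub_cancel_left, norm_smul, Real.norm_eq_abs] at h1
    refine h1.trans ?_
    push_cast
    rw [← two_mul]
    gcongr
  rw [h, norm_smul, norm_inv, Real.norm_eq_abs]
  refine (mul_le_mul_of_nonneg_left hb (by positivity)).trans_eq ?_
  field_simp [abs_ne_zero.2 ht]

lemma norm_segAvg_sub_self_le [CompleteSpace F] {K : ℝ≥0} {e : X} {g : X → F}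
    (hg : LipschitzWith K g) (x : X) : ‖segAvg e g x - g x‖ ≤ K * ‖e‖ := by
  have h : segAvg e g x - g x = ∫ s in (0 : ℝ)..1, (g (x + s • e) - g x) := by
    rw [intervalIntegral.integral_sub (hg.continuous.intervalIntegrable_line x e 0 1) (by simp)]
    simp [segAvg]
  rw [h]
  refine (intervalIntegral.norm_integral_le_of_norm_le_const (C := K * ‖e‖) fun s hs => ?_).trans
    (by simp)
  rw [uIoc_of_le zero_le_one] at hs
  have h1 := hg.dist_le_mul (x + s • e) x
  rw [dist_eq_norm, dist_eq_norm, add_sub_cancel_left, norm_smul, Real.norm_eq_abs,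
    abs_of_pos hs.1] at h1
  refine h1.trans ?_
  gcongr
  exact mul_le_of_le_one_left (norm_nonneg e) hs.2

lemma norm_boxAvg_le (e : ℕ → X) (N : ℕ) {g : X → F} {B : ℝ} (h : ∀ x, ‖g x‖ ≤ B) (x : X) :
    ‖boxAvg e N g x‖ ≤ B := by
  induction N generalizing g with
  | zero => exact h x
  | succ N ih => exact ih (norm_segAvg_le h)

lemma boxAvg_sub (e : ℕ → X) (N : ℕ) {K L : ℝ≥0} {g h : X → F} (hg : LipschitzWith K g)
    (hh : LipschitzWith L h) : boxAvg e N (g - h) = boxAvg e N g - boxAvg e N h := by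
  induction N generalizing g h with
  | zero => rfl
  | succ N ih =>
    simp only [boxAvg]
    rw [segAvg_sub hg.continuous hh.continuous, ih (hg.segAvg _) (hh.segAvg _)]

lemma boxAvg_smul (e : ℕ → X) (N : ℕ) (c : ℝ) (g : X → F) :
    boxAvg e N (c • g) = c • boxAvg e N g := by
  induction N generalizing g with
  | zero => rfl
  | succ N ih => simp only [boxAvg]; rw [segAvg_smul, ih]

lemma boxAvg_const [CompleteSpace F] (e : ℕ → X) (N : ℕ) (c : F) :
    boxAvg e N (fun _ => c) = fun _ => c := by
  induction N with
  | zero => rfl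
  | succ N ih =>
    have h : segAvg (e N) (fun _ => c) = fun _ => c := by ext x; simp [segAvg]
    rw [boxAvg, h, ih]

lemma ContinuousLinearMap.boxAvg_comp {G : Type*} [NormedAddCommGroup G] [NormedSpace ℝ G]
    [CompleteSpace F] [CompleteSpace G] (β : F →L[ℝ] G) (e : ℕ → X) (N : ℕ) {K : ℝ≥0} {g : X → F}
    (hg : LipschitzWith K g) (x : X) :
    β (boxAvg e N g x) = boxAvg e N (β ∘ g) x := by
  induction N generalizing g with
  | zero => rfl
  | succ N ih =>
    simp only [boxAvg]
    rw [ih (hg.segAvg _)]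
    congr 1
    ext y
    exact (β.intervalIntegral_comp_comm (hg.continuous.intervalIntegrable_line y (e N) 0 1)).symm

/-- A bound on `segAvg (e n) (D g)` propagates to all box averages of `D g` that involve the
direction `e n`, provided `D` commutes with averaging. -/
lemma norm_boxAvg_le_of_commute (e : ℕ → X) (Q : (X → F) → Prop) (D : (X → F) → X → F) {C : ℝ}
    {n : ℕ} (hQ : ∀ v g, Q g → Q (segAvg v g))
    (hD : ∀ v g, Q g → segAvg v (D g) = D (segAvg v g))
    (hC : ∀ g, Q g → ∀ x, ‖segAvg (e n) (D g) x‖ ≤ C) {N : ℕ} (hN : n + 1 ≤ N) {g : X → F}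
    (hg : Q g) (x : X) : ‖boxAvg e N (D g) x‖ ≤ C := by
  induction N, hN using Nat.le_induction generalizing g with
  | base => exact norm_boxAvg_le e n (hC g hg) x
  | succ N _ ih =>
    rw [boxAvg, hD _ _ hg]
    exact ih (hQ _ _ hg)

/-- The limit of the averages over growing parallelepipeds. -/
noncomputable def boxMean (e : ℕ → X) (g : X → F) : F :=
  limUnder atTop fun N => boxAvg e N g 0

variable [CompleteSpace F] {e : ℕ → X}

lemma tendsto_boxAvg (he : Summable fun n => ‖e n‖) {K : ℝ≥0} {g : X → F}
    (hg : LipschitzWith K g) :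
    Tendsto (fun N => boxAvg e N g 0) atTop (𝓝 (boxMean e g)) := by
  refine tendsto_nhds_limUnder (cauchySeq_tendsto_of_complete
    (cauchySeq_of_dist_le_of_summable _ (fun N => ?_) (he.mul_left (K : ℝ))))
  rw [dist_comm, dist_eq_norm]
  have h : boxAvg e (N + 1) g 0 - boxAvg e N g 0 = boxAvg e N (segAvg (e N) g - g) 0 := by
    rw [boxAvg_sub e N (hg.segAvg _) hg]
    rfl
  rw [h]
  exact norm_boxAvg_le e N (norm_segAvg_sub_self_le hg) 0

lemma boxMean_sub (he : Summable fun n => ‖e n‖) {K L : ℝ≥0} {g h : X → F}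
    (hg : LipschitzWith K g) (hh : LipschitzWith L h) :
    boxMean e (g - h) = boxMean e g - boxMean e h := by
  refine tendsto_nhds_unique (tendsto_boxAvg he (hg.sub hh)) ?_
  refine ((tendsto_boxAvg he hg).sub (tendsto_boxAvg he hh)).congr fun N => ?_
  rw [boxAvg_sub e N hg hh]
  rfl

lemma boxMean_smul (he : Summable fun n => ‖e n‖) {K : ℝ≥0} {g : X → F}
    (hg : LipschitzWith K g) (c : ℝ) : boxMean e (c • g) = c • boxMean e g := by
  refine tendsto_nhds_unique (tendsto_boxAvg he (hg.real_smul c)) ?_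
  refine ((tendsto_boxAvg he hg).const_smul c).congr fun N => ?_
  rw [boxAvg_smul]
  rfl

lemma norm_boxMean_le (he : Summable fun n => ‖e n‖) {K : ℝ≥0} {g : X → F}
    (hg : LipschitzWith K g) {B : ℝ} (h : ∀ x, ‖g x‖ ≤ B) : ‖boxMean e g‖ ≤ B :=
  le_of_tendsto (tendsto_boxAvg he hg).norm (Eventually.of_forall fun N => norm_boxAvg_le e N h 0)

lemma norm_boxMean_fwdDiff_smul_le (he : Summable fun n => ‖e n‖) {K : ℝ≥0} {g : X → F}
    (hg : LipschitzWith K g) {B : ℝ} (h : ∀ x, ‖g x‖ ≤ B) (n : ℕ) (t : ℝ) :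
    ‖boxMean e (fwdDiff (t • e n) g)‖ ≤ 2 * B * |t| := by
  refine le_of_tendsto (tendsto_boxAvg he (hg.fwdDiff _)).norm ?_
  filter_upwards [eventually_ge_atTop (n + 1)] with N hN
  exact norm_boxAvg_le_of_commute e (fun g => LipschitzWith K g ∧ ∀ x, ‖g x‖ ≤ B)
    (fwdDiff (t • e n)) (fun v g hg => ⟨hg.1.segAvg v, norm_segAvg_le hg.2⟩)
    (fun v g hg => segAvg_fwdDiff hg.1.continuous _)
    (fun g hg => norm_segAvg_fwdDiff_smul_self_le hg.1.continuous hg.2 t) hN ⟨hg, h⟩ 0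

lemma norm_boxMean_quotient_sub_le (he : Summable fun n => ‖e n‖) {K : ℝ≥0} {g : X → F}
    (hg : LipschitzWith K g) (n : ℕ) {t s : ℝ} (ht : t ≠ 0) (hs : s ≠ 0) :
    ‖t⁻¹ • boxMean e (fwdDiff (t • e n) g) - s⁻¹ • boxMean e (fwdDiff (s • e n) g)‖ ≤
      2 * K * ‖e n‖ * (|t| + |s|) := by
  have hl : ∀ {h : X → F}, LipschitzWith K h → ∀ r : ℝ, LipschitzWith (‖r⁻¹‖₊ * (K + K))
      (r⁻¹ • fwdDiff (r • e n) h) := fun hh r => (hh.fwdDiff _).real_smul _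
  rw [← boxMean_smul he (hg.fwdDiff _), ← boxMean_smul he (hg.fwdDiff _),
    ← boxMean_sub he (hl hg t) (hl hg s)]
  refine le_of_tendsto (tendsto_boxAvg he ((hl hg t).sub (hl hg s))).norm ?_
  filter_upwards [eventually_ge_atTop (n + 1)] with N hN
  have hD : ∀ (v : X) (h : X → F), LipschitzWith K h →
      segAvg v (t⁻¹ • fwdDiff (t • e n) h - s⁻¹ • fwdDiff (s • e n) h) =
      t⁻¹ • fwdDiff (t • e n) (segAvg v h) - s⁻¹ • fwdDiff (s • e n) (segAvg v h) := by
    intro v h hh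
    rw [segAvg_sub (hl hh t).continuous (hl hh s).continuous, segAvg_smul, segAvg_smul,
      segAvg_fwdDiff hh.continuous, segAvg_fwdDiff hh.continuous]
  refine norm_boxAvg_le_of_commute e (LipschitzWith K)
    (fun h => t⁻¹ • fwdDiff (t • e n) h - s⁻¹ • fwdDiff (s • e n) h)
    (fun v h hh => hh.segAvg v) hD (fun h hh x => ?_) hN hg 0
  rw [segAvg_sub (hl hh t).continuous (hl hh s).continuous, segAvg_smul, segAvg_smul,
    mul_add]
  have h1 := norm_inv_smul_segAvg_sub_le (e := e n) hh ht x
  have h2 := norm_inv_smul_segAvg_sub_le (e := e n) hh hs x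
  refine le_trans (le_of_eq ?_) ((norm_sub_le _ _).trans (add_le_add h1 h2))
  simp

lemma boxMean_add (he : Summable fun n => ‖e n‖) {K L : ℝ≥0} {g h : X → F}
    (hg : LipschitzWith K g) (hh : LipschitzWith L h) :
    boxMean e (g + h) = boxMean e g + boxMean e h := by
  have := boxMean_sub he (hg.add hh) hh
  rw [show (fun x => g x + h x) - h = g from add_sub_cancel_right g h] at this
  rw [this]
  exact (sub_add_cancel _ _).symm

lemma boxMean_fwdDiff_zero (he : Summable fun n => ‖e n‖) (g : X → F) :
    boxMean e (fwdDiff 0 g) = 0 := by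
  have h : fwdDiff 0 g = fun _ => (0 : F) := by ext x; simp [fwdDiff]
  rw [h, ← norm_le_zero_iff]
  exact norm_boxMean_le he (LipschitzWith.const (0 : F)) (by simp)

lemma ContinuousLinearMap.boxMean_fwdDiff [CompleteSpace X] (he : Summable fun n => ‖e n‖)
    {K : ℝ≥0} {g : X → F} (hg : LipschitzWith K g) (β : F →L[ℝ] X) (hβ : ∀ x, β (g x) = x) (v : X) :
    β (boxMean e (fwdDiff v g)) = v := by
  refine tendsto_nhds_unique ((β.continuous.tendsto _).comp (tendsto_boxAvg he (hg.fwdDiff v)))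
    (tendsto_const_nhds.congr fun N => ?_)
  have h : β ∘ fwdDiff v g = fun _ => v := by ext x; simp [fwdDiff, hβ]
  rw [Function.comp_apply, β.boxAvg_comp e N (hg.fwdDiff v), h, boxAvg_const]

/-- The averaging process is asymptotically invariant under translation along `v`, and the averaged
difference quotients of `g` along `v` converge to `u`. -/
def HasMeanDeriv (e : ℕ → X) (g : X → F) (v : X) (u : F) : Prop :=
  (∃ C : ℝ, ∀ (L : ℝ≥0) (h : X → F) (B : ℝ), LipschitzWith L h → (∀ x, ‖h x‖ ≤ B) →
    ∀ t : ℝ, ‖boxMean e (fwdDiff (t • v) h)‖ ≤ C * B * |t|) ∧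
  Tendsto (fun t : ℝ => t⁻¹ • boxMean e (fwdDiff (t • v) g)) (𝓝[≠] 0) (𝓝 u)

lemma HasMeanDeriv.zero (he : Summable fun n => ‖e n‖) (g : X → F) : HasMeanDeriv e g 0 0 := by
  refine ⟨⟨0, fun L h B hL hB t => ?_⟩, ?_⟩
  · simp [boxMean_fwdDiff_zero he]
  · simp [boxMean_fwdDiff_zero he]

lemma HasMeanDeriv.add (he : Summable fun n => ‖e n‖) {K : ℝ≥0} {g : X → F}
    (hg : LipschitzWith K g) {v w : X} {u y : F} (hv : HasMeanDeriv e g v u)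
    (hw : HasMeanDeriv e g w y) : HasMeanDeriv e g (v + w) (u + y) := by
  obtain ⟨⟨C, hC⟩, hu⟩ := hv
  obtain ⟨⟨D, hD⟩, hy⟩ := hw
  refine ⟨⟨C + D, fun L h B hL hB t => ?_⟩, ?_⟩
  · have hs : LipschitzWith L (fun x => h (x + t • w)) := LipschitzWith.of_dist_le_mul
      fun a b => by simpa using hL.dist_le_mul (a + t • w) (b + t • w)
    have hd : fwdDiff (t • (v + w)) h =
        fwdDiff (t • v) (fun x => h (x + t • w)) + fwdDiff (t • w) h := by
      ext x
      simp [fwdDiff, smul_add, add_assoc]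
    rw [hd, boxMean_add he (hs.fwdDiff _) (hL.fwdDiff _)]
    refine (norm_add_le _ _).trans ?_
    linarith [hC L _ B hs (fun x => hB _) t, hD L h B hL hB t]
  · have hd : ∀ t : ℝ, boxMean e (fwdDiff (t • (v + w)) g) =
        boxMean e (fwdDiff (t • v) (fwdDiff (t • w) g)) +
          (boxMean e (fwdDiff (t • v) g) + boxMean e (fwdDiff (t • w) g)) := fun t => by
      have hs : LipschitzWith (K + K + (K + K)) (fwdDiff (t • v) g + fwdDiff (t • w) g) :=
        (hg.fwdDiff _).add (hg.fwdDiff _)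
      rw [← boxMean_add he (hg.fwdDiff _) (hg.fwdDiff _),
        ← boxMean_add he ((hg.fwdDiff _).fwdDiff _) hs]
      congr 1
      ext x
      simp only [fwdDiff, Pi.add_apply, smul_add, ← add_assoc]
      rw [add_right_comm x]
      abel
    have h0 : Tendsto (fun t : ℝ => t⁻¹ • boxMean e (fwdDiff (t • v) (fwdDiff (t • w) g)))
        (𝓝[≠] 0) (𝓝 0) := by
      have hl : Tendsto (fun t : ℝ => C * (K * ‖w‖) * |t|) (𝓝[≠] 0) (𝓝 0) :=
        tendsto_nhdsWithin_of_tendsto_nhds (Continuous.tendsto' (by fun_prop) _ _ (by simp))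
      refine squeeze_zero_norm' ?_ hl
      filter_upwards [self_mem_nhdsWithin] with t ht
      have hb := hC _ _ (K * ‖t • w‖) (hg.fwdDiff (t • w)) (hg.norm_fwdDiff_le _) t
      rw [norm_smul, norm_inv, Real.norm_eq_abs, inv_mul_le_iff₀ (abs_pos.2 ht)]
      rw [norm_smul, Real.norm_eq_abs] at hb
      linarith
    have := h0.add (hu.add hy)
    rw [zero_add] at this
    refine this.congr fun t => ?_
    rw [hd, smul_add, smul_add]

lemma HasMeanDeriv.smul (he : Summable fun n => ‖e n‖) {g : X → F} {v : X} {u : F}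
    (hv : HasMeanDeriv e g v u) (c : ℝ) : HasMeanDeriv e g (c • v) (c • u) := by
  rcases eq_or_ne c 0 with rfl | hc
  · simpa using HasMeanDeriv.zero he g
  obtain ⟨⟨C, hC⟩, hu⟩ := hv
  refine ⟨⟨C * |c|, fun L h B hL hB t => ?_⟩, ?_⟩
  · rw [smul_smul]
    refine (hC L h B hL hB (t * c)).trans_eq ?_
    rw [abs_mul]
    ring
  · have hm : Tendsto (fun t : ℝ => t * c) (𝓝[≠] 0) (𝓝[≠] 0) := by
      refine tendsto_nhdsWithin_iff.2 ⟨tendsto_nhdsWithin_of_tendsto_nhds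
        (Continuous.tendsto' (by fun_prop) _ _ (by simp)), ?_⟩
      filter_upwards [self_mem_nhdsWithin] with t ht
      exact mul_ne_zero ht hc
    refine ((hu.comp hm).const_smul c).congr fun t => ?_
    simp only [Function.comp_apply, smul_smul, mul_inv]
    congr 1
    field_simp

lemma HasMeanDeriv.norm_le (he : Summable fun n => ‖e n‖) {K : ℝ≥0} {g : X → F}
    (hg : LipschitzWith K g) {v : X} {u : F} (hv : HasMeanDeriv e g v u) : ‖u‖ ≤ K * ‖v‖ := by
  refine le_of_tendsto hv.2.norm ?_
  filter_upwards [self_mem_nhdsWithin] with t ht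
  have h := norm_boxMean_le he (hg.fwdDiff (t • v)) (hg.norm_fwdDiff_le (t • v))
  rw [norm_smul, Real.norm_eq_abs] at h
  rw [norm_smul, norm_inv, Real.norm_eq_abs, inv_mul_le_iff₀ (abs_pos.2 ht)]
  linarith

lemma HasMeanDeriv.apply_eq [CompleteSpace X] (he : Summable fun n => ‖e n‖) {K : ℝ≥0}
    {g : X → F} (hg : LipschitzWith K g) {v : X} {u : F} (hv : HasMeanDeriv e g v u)
    (β : F →L[ℝ] X) (hβ : ∀ x, β (g x) = x) : β u = v := by
  refine tendsto_nhds_unique ((β.continuous.tendsto _).comp hv.2)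
    (tendsto_const_nhds.congr' ?_)
  filter_upwards [self_mem_nhdsWithin] with t ht
  rw [Function.comp_apply, map_smul, β.boxMean_fwdDiff he hg hβ, smul_smul, inv_mul_cancel₀ ht,
    one_smul]

lemma exists_hasMeanDeriv (he : Summable fun n => ‖e n‖) {K : ℝ≥0} {g : X → F}
    (hg : LipschitzWith K g) (n : ℕ) : ∃ u, HasMeanDeriv e g (e n) u := by
  refine (exists_and_left (b := _)).2
    ⟨⟨2, fun L h B hL hB t => norm_boxMean_fwdDiff_smul_le he hL hB n t⟩, ?_⟩
  refine cauchy_map_iff_exists_tendsto.1 (Metric.cauchy_iff.2 ⟨inferInstance, fun ε hε => ?_⟩)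
  have hl : Tendsto (fun t : ℝ => 2 * K * ‖e n‖ * (|t| + |t|)) (𝓝[≠] 0) (𝓝 0) :=
    tendsto_nhdsWithin_of_tendsto_nhds (Continuous.tendsto' (by fun_prop) _ _ (by simp))
  refine ⟨_, image_mem_map (inter_mem (hl.eventually (gt_mem_nhds hε)) self_mem_nhdsWithin), ?_⟩
  rintro _ ⟨t, ⟨ht, ht0⟩, rfl⟩ _ ⟨s, ⟨hs, hs0⟩, rfl⟩
  rw [dist_eq_norm]
  refine (norm_boxMean_quotient_sub_le he hg n ht0 hs0).trans_lt ?_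
  simp only [mem_ofPred_eq] at ht hs
  linarith

/-- A Lipschitz right inverse of a bounded operator onto a Banach space can be linearized on the
span of any sequence. -/
lemma exists_linear_rightInverse_on_span [CompleteSpace X] {K : ℝ≥0} {g : X → F}
    (hg : LipschitzWith K g) (β : F →L[ℝ] X) (hβ : ∀ x, β (g x) = x) (z : ℕ → X) :
    ∃ U : Submodule.span ℝ (Set.range z) →L[ℝ] F,
      (∀ v, β (U v) = v) ∧ ∀ v, ‖U v‖ ≤ K * ‖v‖ := by
  set c : ℕ → ℝ := fun n => (1 / 2) ^ n / (1 + ‖z n‖)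
  have hc0 : ∀ n, 0 < c n := fun n => by positivity
  have he : Summable fun n => ‖c n • z n‖ := by
    refine Summable.of_nonneg_of_le (fun n => norm_nonneg _) (fun n => ?_)
      summable_geometric_two
    rw [norm_smul, Real.norm_of_nonneg (hc0 n).le, div_mul_eq_mul_div, div_le_iff₀ (by positivity)]
    gcongr
    linarith
  have hex : ∀ v : Submodule.span ℝ (Set.range z),
      ∃ u, HasMeanDeriv (fun n => c n • z n) g v u := by
    rintro ⟨v, hv⟩
    induction hv using Submodule.span_induction with
    | mem x hx =>
      obtain ⟨n, rfl⟩ := hx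
      obtain ⟨u, hu⟩ := exists_hasMeanDeriv he hg n
      refine ⟨(c n)⁻¹ • u, ?_⟩
      simpa only [smul_smul, inv_mul_cancel₀ (hc0 n).ne', one_smul] using hu.smul he (c n)⁻¹
    | zero => exact ⟨0, HasMeanDeriv.zero he g⟩
    | add x y _ _ hx hy =>
      obtain ⟨u, hu⟩ := hx
      obtain ⟨w, hw⟩ := hy
      exact ⟨u + w, hu.add he hg hw⟩
    | smul a x _ hx =>
      obtain ⟨u, hu⟩ := hx
      exact ⟨a • u, hu.smul he a⟩
  choose U hU using hex
  let U' : Submodule.span ℝ (Set.range z) →ₗ[ℝ] F :=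
    { toFun := U
      map_add' := fun v w => tendsto_nhds_unique (hU (v + w)).2 ((hU v).add he hg (hU w)).2
      map_smul' := fun a v => tendsto_nhds_unique (hU (a • v)).2 ((hU v).smul he a).2 }
  exact ⟨U'.mkContinuous K fun v => (hU v).norm_le he hg,
    fun v => (hU v).apply_eq he hg β hβ, fun v => (hU v).norm_le he hg⟩

end Averaging

lemma IsFinRank.comp_left {Z V W : Type*} [NormedAddCommGroup Z] [NormedSpace ℝ Z]
    [NormedAddCommGroup V] [NormedSpace ℝ V] [NormedAddCommGroup W] [NormedSpace ℝ W]
    {S : V →L[ℝ] W} (hS : IsFinRank S) (T : Z →L[ℝ] V) : IsFinRank (S.comp T) := by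
  have : FiniteDimensional ℝ (LinearMap.range (S : V →ₗ[ℝ] W)) := hS
  exact Submodule.finiteDimensional_of_le
    (LinearMap.range_comp_le_range (T : Z →ₗ[ℝ] V) (S : V →ₗ[ℝ] W))

lemma IsFinRank.exists_extension {Z W : Type*} [NormedAddCommGroup Z] [NormedSpace ℝ Z]
    [NormedAddCommGroup W] [NormedSpace ℝ W] {V : Submodule ℝ Z} {S : V →L[ℝ] W}
    (hS : IsFinRank S) : ∃ R : Z →L[ℝ] W, IsFinRank R ∧ ∀ v : V, R v = S v := by
  have : FiniteDimensional ℝ (LinearMap.range (S : V →ₗ[ℝ] W)) := hS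
  let S' : V →L[ℝ] LinearMap.range (S : V →ₗ[ℝ] W) :=
    S.codRestrict _ fun v => LinearMap.mem_range_self (S : V →ₗ[ℝ] W) v
  obtain ⟨R, hR⟩ := S'.exist_extension_of_finiteDimensional_range
  refine ⟨(Submodule.subtypeL _).comp R, ?_, fun v => ?_⟩
  · refine Submodule.finiteDimensional_of_le
      (S₂ := LinearMap.range (S : V →ₗ[ℝ] W)) ?_
    rintro _ ⟨x, rfl⟩
    exact (R x).2
  · have := congrArg (fun f => (f v : W)) hR
    exact this.symm

lemma RelPCompact.image {p : ℝ} (hp : 1 ≤ p) {Z W : Type*} [NormedAddCommGroup Z]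
    [NormedSpace ℝ Z] [NormedAddCommGroup W] [NormedSpace ℝ W] {A : Set Z} (hA : RelPCompact p A)
    (T : Z →L[ℝ] W) : RelPCompact p (T '' A) := by
  obtain ⟨z, hz, h⟩ := hA
  refine ⟨fun n => T (z n), ?_, ?_⟩
  · refine Summable.of_nonneg_of_le (fun n => by positivity) (fun n => ?_)
      (hz.mul_left (‖T‖ ^ p))
    rw [← Real.mul_rpow (norm_nonneg _) (norm_nonneg _)]
    exact Real.rpow_le_rpow (norm_nonneg _) (T.le_opNorm _) (by linarith)
  · rintro _ ⟨w, hw, rfl⟩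
    obtain ⟨a, ha, hs⟩ := h w hw
    exact ⟨a, ha, by simpa using T.hasSum hs⟩

lemma InBallConj.summable_smul {p : ℝ} (hp : 1 ≤ p) {Z : Type*} [NormedAddCommGroup Z]
    [NormedSpace ℝ Z] [CompleteSpace Z] {a : ℕ → ℝ} (ha : InBallConj p a) {z : ℕ → Z}
    (hz : Summable fun n => ‖z n‖ ^ p) : Summable fun n => a n • z n := by
  refine Summable.of_norm ?_
  simp only [norm_smul, Real.norm_eq_abs]
  rcases ha with ⟨rfl, ha⟩ | ⟨hp1, ha, -⟩
  · simp only [Real.rpow_one] at hz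
    exact Summable.of_nonneg_of_le (fun n => by positivity)
      (fun n => mul_le_of_le_one_left (norm_nonneg _) (ha n)) hz
  · have hpq := Real.HolderConjugate.conjExponent (lt_of_le_of_ne hp hp1.symm)
    exact Real.summable_mul_of_Lp_Lq_of_nonneg hpq.symm (fun n => abs_nonneg _)
      (fun n => norm_nonneg _) ha hz

theorem stmt_14 (p : ℝ) (hp : 1 ≤ p) {X Y FX : Type*}
    [NormedAddCommGroup X] [NormedSpace ℝ X] [CompleteSpace X]
    [NormedAddCommGroup Y] [NormedSpace ℝ Y] [CompleteSpace Y]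
    [NormedAddCommGroup FX] [NormedSpace ℝ FX] [CompleteSpace FX]
    (δ : X → FX) (hδ : IsFreeSpace δ)
    (β : FX →L[ℝ] X) (hβ : ∀ x : X, β (δ x) = x) :
    (∀ T : X →L[ℝ] Y, ∀ K : Set X, RelPCompact p K → ∀ ε : ℝ, 0 < ε →
        ∃ S : X →L[ℝ] Y, IsFinRank S ∧ ∀ x ∈ K, ‖T x - S x‖ < ε) ↔
      (∀ T : X →L[ℝ] Y, ∀ A : Set FX, RelPCompact p A → ∀ ε : ℝ, 0 < ε →
        ∃ S : FX →L[ℝ] Y, IsFinRank S ∧ ∀ γ ∈ A, ‖T (β γ) - S γ‖ < ε) := by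
  constructor
  · intro H T A hA ε hε
    obtain ⟨S, hS, h⟩ := H T _ (hA.image hp β) ε hε
    exact ⟨S.comp β, hS.comp_left β, fun γ hγ => h _ (mem_image_of_mem β hγ)⟩
  · rintro H T K ⟨z, hz, hK⟩ ε hε
    obtain ⟨U, hβU, hU⟩ := exists_linear_rightInverse_on_span hδ.isometry.lipschitz β hβ z
    let z' : ℕ → Submodule.span ℝ (Set.range z) :=
      fun n => ⟨z n, Submodule.subset_span (Set.mem_range_self n)⟩
    have hUz : Summable fun n => ‖U (z' n)‖ ^ p := by
      refine Summable.of_nonneg_of_le (fun n => by positivity) (fun n => ?_) hz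
      exact Real.rpow_le_rpow (norm_nonneg _) (by simpa [z'] using hU (z' n)) (by linarith)
    obtain ⟨S, hS, h⟩ := H T {γ | ∃ a, InBallConj p a ∧ HasSum (fun n => a n • U (z' n)) γ}
      ⟨_, hUz, fun γ hγ => hγ⟩ ε hε
    obtain ⟨R, hR, hRS⟩ := (hS.comp_left U).exists_extension
    refine ⟨R, hR, fun x hx => ?_⟩
    obtain ⟨a, ha, hax⟩ := hK x hx
    obtain ⟨γ, hγ⟩ := ha.summable_smul hp hUz
    have hβγ : β γ = x := by
      refine (β.hasSum hγ).unique ?_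
      simpa [hβU, z'] using hax
    have hSγ : S γ = R x := by
      refine (S.hasSum hγ).unique ?_
      have hRz : ∀ n, R (z n) = S (U (z' n)) := fun n => hRS (z' n)
      simpa [hRz] using R.hasSum hax
    rw [← hSγ, ← hβγ]
    exact h γ ⟨a, ha, hγ⟩
end

section
/- Let 1 ≤ p < ∞, let X be a real normed linear space and Y a real Banach space. Then 𝒦_p^{Ld}(X,Y) ⊆ Π_p^L(X,Y), and π_p^L(f) ≤ k_p^{Ld}(f) for every f ∈ 𝒦_p^{Ld}(X,Y). -/
open scoped NNReal ZeroAtInfty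
open Metric Set

/-- A `p`-compact bounded linear operator: it maps the closed unit ball to a relatively
`p`-compact set. -/
def PCompactOp (p : ℝ) {Z W : Type*} [NormedAddCommGroup Z] [NormedSpace ℝ Z]
    [NormedAddCommGroup W] [NormedSpace ℝ W] (T : Z →L[ℝ] W) : Prop :=
  RelPCompact p (T '' Metric.closedBall (0 : Z) 1)

/-- The `p`-compactness norm `k_p(T)`: the infimum of `(Σ ‖w n‖ ^ p) ^ (1/p)` over all strongly
`p`-summable sequences `w` whose `p`-convex hull contains the image of the closed unit ball. -/
noncomputable def kp (p : ℝ) {Z W : Type*} [NormedAddCommGroup Z] [NormedSpace ℝ Z]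
    [NormedAddCommGroup W] [NormedSpace ℝ W] (T : Z →L[ℝ] W) : ℝ :=
  sInf { c : ℝ | ∃ w : ℕ → W, Summable (fun n => ‖w n‖ ^ p) ∧
    (∀ v ∈ T '' Metric.closedBall (0 : Z) 1,
      ∃ a : ℕ → ℝ, InBallConj p a ∧ HasSum (fun n => a n • w n) v) ∧
    c = (∑' n, ‖w n‖ ^ p) ^ (1 / p) }

/-- `f` is Lipschitz `p`-summing with constant `C` (the defining inequality, raised to the
`p`-th power, the supremum being over the unit ball of the Lipschitz dual `X^#`). -/
def LipPSummingWith (p : ℝ) {X Y : Type*} [NormedAddCommGroup X] [NormedAddCommGroup Y]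
    (f : X → Y) (C : ℝ) : Prop :=
  ∀ (n : ℕ) (x y : Fin n → X) (lam : Fin n → ℝ), (∀ i, 0 ≤ lam i) →
    (∑ i, lam i * ‖f (x i) - f (y i)‖ ^ p) ≤
      C ^ p * ⨆ g : { g : X → ℝ // g 0 = 0 ∧ LipschitzWith 1 g },
        ∑ i, lam i * |g.1 (x i) - g.1 (y i)| ^ p

/-- The Lipschitz `p`-summing norm `π_p^L(f)`. -/
noncomputable def lipPSummingNorm (p : ℝ) {X Y : Type*} [NormedAddCommGroup X]
    [NormedAddCommGroup Y] (f : X → Y) : ℝ :=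
  sInf { C : ℝ | 0 ≤ C ∧ LipPSummingWith p f C }

/-- The Hölder inequality for coefficients in the unit ball of the conjugate sequence space. -/
theorem InBallConj.abs_rpow_le_tsum {p : ℝ} (hp : 1 ≤ p) {a b : ℕ → ℝ} (ha : InBallConj p a)
    (hb : Summable fun n => |b n| ^ p) {s : ℝ} (hs : HasSum (fun n => a n * b n) s) :
    |s| ^ p ≤ ∑' n, |b n| ^ p := by
  rcases ha with ⟨rfl, ha⟩ | ⟨hp1, hsum, hle⟩
  · simp only [Real.rpow_one] at hb ⊢
    have hbound : ∀ n, ‖a n * b n‖ ≤ |b n| := fun n => by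
      rw [norm_mul, Real.norm_eq_abs, Real.norm_eq_abs]
      exact mul_le_of_le_one_left (abs_nonneg _) (ha n)
    rw [← hs.tsum_eq]
    exact tsum_of_norm_bounded hb.hasSum hbound
  · have hlt : 1 < p := lt_of_le_of_ne hp (Ne.symm hp1)
    have hpq : (p / (p - 1)).HolderConjugate p := (Real.HolderConjugate.conjExponent hlt).symm
    obtain ⟨habs, hholder⟩ := Real.summable_and_inner_le_Lp_mul_Lq_tsum_of_nonneg hpq
      (fun n => abs_nonneg (a n)) (fun n => abs_nonneg (b n)) hsum hb
    have hnonneg : 0 ≤ ∑' n, |b n| ^ p := tsum_nonneg fun n => by positivity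
    have hs_le : |s| ≤ ∑' n, |a n| * |b n| := by
      have hbound : ∀ n, ‖a n * b n‖ ≤ |a n| * |b n| := fun n => by
        rw [norm_mul, Real.norm_eq_abs, Real.norm_eq_abs]
      rw [← hs.tsum_eq]
      exact tsum_of_norm_bounded habs.hasSum hbound
    have hcoeff : (∑' n, |a n| ^ (p / (p - 1))) ^ (1 / (p / (p - 1))) ≤ 1 :=
      Real.rpow_le_one (tsum_nonneg fun n => by positivity) hle hpq.one_div_nonneg
    have hroot : |s| ≤ (∑' n, |b n| ^ p) ^ (1 / p) :=
      (hs_le.trans hholder).trans (mul_le_of_le_one_left (by positivity) hcoeff)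
    calc |s| ^ p ≤ ((∑' n, |b n| ^ p) ^ (1 / p)) ^ p :=
          Real.rpow_le_rpow (abs_nonneg _) hroot (by linarith)
      _ = ∑' n, |b n| ^ p := by
          rw [← Real.rpow_mul hnonneg, one_div_mul_cancel (by linarith), Real.rpow_one]

/-- The sums defining the weak Lipschitz `p`-norm of a finite family are bounded above. -/
theorem bddAbove_range_lip_sum {p : ℝ} (hp : 0 ≤ p) {X : Type*} [NormedAddCommGroup X] {n : ℕ}
    (x y : Fin n → X) {lam : Fin n → ℝ} (hlam : ∀ i, 0 ≤ lam i) :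
    BddAbove (range fun g : { g : X → ℝ // g 0 = 0 ∧ LipschitzWith 1 g } =>
      ∑ i, lam i * |g.1 (x i) - g.1 (y i)| ^ p) := by
  refine ⟨∑ i, lam i * ‖x i - y i‖ ^ p, ?_⟩
  rintro _ ⟨g, rfl⟩
  refine Finset.sum_le_sum fun i _ => mul_le_mul_of_nonneg_left ?_ (hlam i)
  refine Real.rpow_le_rpow (abs_nonneg _) ?_ hp
  simpa [Real.dist_eq, dist_eq_norm] using g.2.2.dist_le_mul (x i) (y i)

section LipDual

variable {X Xs : Type*} [NormedAddCommGroup X] [NormedAddCommGroup Xs] [NormedSpace ℝ Xs]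
  {e : Xs →ₗ[ℝ] (X → ℝ)}

theorem IsLipDual.abs_sub_le_s17 (he : IsLipDual e) (h : Xs) (x y : X) :
    |e h x - e h y| ≤ ‖h‖ * ‖x - y‖ := by
  simpa [Real.dist_eq, dist_eq_norm] using (he.lip_norm h).dist_le_mul x y

/-- Evaluation of increments preserves sums in the Lipschitz dual. -/
theorem IsLipDual.hasSum_sub (he : IsLipDual e) {a : ℕ → ℝ} {w : ℕ → Xs} {h : Xs}
    (hs : HasSum (fun n => a n • w n) h) (x y : X) :
    HasSum (fun n => a n * (e (w n) x - e (w n) y)) (e h x - e h y) := by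
  let δ : X → (X → ℝ) →ₗ[ℝ] ℝ := LinearMap.proj
  let ev : Xs →ₗ[ℝ] ℝ := (δ x - δ y) ∘ₗ e
  let E : Xs →L[ℝ] ℝ := ev.mkContinuous ‖x - y‖ fun h => by
    rw [mul_comm]
    exact he.abs_sub_le_s17 h x y
  have hE : ∀ h, E h = e h x - e h y := fun _ => rfl
  simpa only [hE, map_smul, Pi.smul_apply, smul_eq_mul, mul_sub] using E.hasSum hs

/-- Homogeneity: an element of the Lipschitz dual is controlled by its norm times the supremum
over the unit ball. -/
theorem IsLipDual.sum_le_norm_rpow_mul_iSup (he : IsLipDual e) {p : ℝ} (hp : 0 < p) {n : ℕ}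
    (x y : Fin n → X) {lam : Fin n → ℝ} (hlam : ∀ i, 0 ≤ lam i) (h : Xs) :
    ∑ i, lam i * |e h (x i) - e h (y i)| ^ p ≤
      ‖h‖ ^ p * ⨆ g : { g : X → ℝ // g 0 = 0 ∧ LipschitzWith 1 g },
        ∑ i, lam i * |g.1 (x i) - g.1 (y i)| ^ p := by
  rcases eq_or_ne h 0 with rfl | hh
  · simp [Real.zero_rpow hp.ne']
  have hpos : 0 < ‖h‖ := norm_pos_iff.2 hh
  have hlip : LipschitzWith 1 (e (‖h‖⁻¹ • h)) := by
    refine (he.lip_norm _).weaken ?_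
    rw [← NNReal.coe_le_coe, coe_nnnorm, norm_smul, norm_inv, norm_norm,
      inv_mul_cancel₀ hpos.ne', NNReal.coe_one]
  have hle := le_ciSup (bddAbove_range_lip_sum hp.le x y hlam)
    ⟨e (‖h‖⁻¹ • h), he.map_zero_pt _, hlip⟩
  refine le_trans (le_of_eq ?_) (mul_le_mul_of_nonneg_left hle (by positivity))
  rw [Finset.mul_sum]
  refine Finset.sum_congr rfl fun i _ => ?_
  simp only [map_smul]
  rw [Pi.smul_apply, Pi.smul_apply, smul_eq_mul, smul_eq_mul, ← mul_sub, abs_mul,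
    abs_of_pos (inv_pos.2 hpos), mul_left_comm, ← Real.mul_rpow hpos.le (by positivity),
    mul_inv_cancel_left₀ hpos.ne']

/-- A sequence whose `p`-convex hull contains the image of the dual ball under the Lipschitz
transpose witnesses that the map is Lipschitz `p`-summing. -/
theorem IsLipDual.lipPSummingWith (he : IsLipDual e) {p : ℝ} (hp : 1 ≤ p) {Y : Type*}
    [NormedAddCommGroup Y] [NormedSpace ℝ Y] {f : X → Y} {ft : (Y →L[ℝ] ℝ) →L[ℝ] Xs}
    (hft : ∀ (ψ : Y →L[ℝ] ℝ) (x : X), e (ft ψ) x = ψ (f x)) {w : ℕ → Xs}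
    (hw : Summable fun n => ‖w n‖ ^ p)
    (hcov : ∀ v ∈ ft '' closedBall 0 1,
      ∃ a : ℕ → ℝ, InBallConj p a ∧ HasSum (fun n => a n • w n) v) :
    LipPSummingWith p f ((∑' n, ‖w n‖ ^ p) ^ (1 / p)) := by
  have hp0 : 0 < p := by linarith
  intro n x y lam hlam
  have hsummable : ∀ u v : X, Summable fun k => |e (w k) u - e (w k) v| ^ p := fun u v => by
    refine Summable.of_nonneg_of_le (fun k => by positivity) (fun k => ?_)
      (hw.mul_right (‖u - v‖ ^ p))
    rw [← Real.mul_rpow (norm_nonneg _) (norm_nonneg _)]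
    exact Real.rpow_le_rpow (abs_nonneg _) (he.abs_sub_le_s17 _ _ _) hp0.le
  have hpoint : ∀ u v : X, ‖f u - f v‖ ^ p ≤ ∑' k, |e (w k) u - e (w k) v| ^ p := fun u v => by
    obtain ⟨ψ, hψ, hval⟩ := exists_dual_vector'' ℝ (f u - f v)
    obtain ⟨a, ha, hs⟩ := hcov (ft ψ) ⟨ψ, by simpa using hψ, rfl⟩
    have hs' := he.hasSum_sub hs u v
    rw [hft, hft, ← map_sub, hval] at hs'
    simpa using ha.abs_rpow_le_tsum hp (hsummable u v) hs'
  rw [← Real.rpow_mul (tsum_nonneg fun k => by positivity), one_div_mul_cancel hp0.ne',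
    Real.rpow_one]
  calc ∑ i, lam i * ‖f (x i) - f (y i)‖ ^ p
      ≤ ∑ i, lam i * ∑' k, |e (w k) (x i) - e (w k) (y i)| ^ p :=
        Finset.sum_le_sum fun i _ => mul_le_mul_of_nonneg_left (hpoint _ _) (hlam i)
    _ = ∑' k, ∑ i, lam i * |e (w k) (x i) - e (w k) (y i)| ^ p := by
        rw [Summable.tsum_finsetSum fun i _ => (hsummable _ _).mul_left _]
        simp only [tsum_mul_left]
    _ ≤ ∑' k, ‖w k‖ ^ p * ⨆ g : { g : X → ℝ // g 0 = 0 ∧ LipschitzWith 1 g },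
          ∑ i, lam i * |g.1 (x i) - g.1 (y i)| ^ p :=
        Summable.tsum_le_tsum (fun k => he.sum_le_norm_rpow_mul_iSup hp0 x y hlam (w k))
          (summable_sum fun i _ => (hsummable _ _).mul_left _) (hw.mul_right _)
    _ = _ := tsum_mul_right

end LipDual

theorem stmt_17 (p : ℝ) (hp : 1 ≤ p) {X Y Xs : Type*}
    [NormedAddCommGroup X] [NormedSpace ℝ X]
    [NormedAddCommGroup Y] [NormedSpace ℝ Y] [CompleteSpace Y]
    [NormedAddCommGroup Xs] [NormedSpace ℝ Xs] [CompleteSpace Xs]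
    (e : Xs →ₗ[ℝ] (X → ℝ)) (he : IsLipDual e)
    (f : X → Y) (hf : IsLip0 f)
    (ft : (Y →L[ℝ] ℝ) →L[ℝ] Xs)
    (hft : ∀ (ψ : Y →L[ℝ] ℝ) (x : X), e (ft ψ) x = ψ (f x))
    (hK : PCompactOp p ft) :
    (∃ C : ℝ, 0 ≤ C ∧ LipPSummingWith p f C) ∧ lipPSummingNorm p f ≤ kp p ft := by
  obtain ⟨z, hz, hcov⟩ := hK
  refine ⟨⟨_, ?_, he.lipPSummingWith hp hft hz hcov⟩, ?_⟩
  · exact Real.rpow_nonneg (tsum_nonneg fun n => by positivity) _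
  · refine le_csInf ⟨_, z, hz, hcov, rfl⟩ ?_
    rintro c ⟨w, hw, hwcov, rfl⟩
    exact csInf_le ⟨0, fun C hC => hC.1⟩
      ⟨Real.rpow_nonneg (tsum_nonneg fun n => by positivity) _,
        he.lipPSummingWith hp hft hw hwcov⟩
end
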